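/- Let R be a 4-dimensional Noetherian local unique factorization domain, I an ideal of R, and M a finitely generated R-module. Then there is an ideal D of R with dim R/D ≤ 1 such that for all x in D and all i ≥ 0, the localization H^i_I(M)_x is I_x-cofinite. -/

import Mathlib

open CategoryTheory

noncomputable section

universe u

/-- The Krull dimension of a module: `dim R/ann(M)`. -/
def moduleDim (R : Type u) [CommRing R] (M : Type*) [AddCommGroup M] [Module R M] :
    WithBot (WithTop ℕ) :=
  ringKrullDim (R ⧸ Module.annihilator R M)

/-- The depth of `M` with respect to an ideal `J`: the supremum of the lengths of
`M`-regular sequences consisting of elements of `J`. -/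
def moduleDepth (R : Type u) [CommRing R] (J : Ideal R) (M : Type*) [AddCommGroup M]
    [Module R M] : ℕ∞ :=
  sSup {n : ℕ∞ | ∃ rs : List R, (rs.length : ℕ∞) = n ∧ (∀ r ∈ rs, r ∈ J) ∧
    RingTheory.Sequence.IsRegular M rs}

/-- Serre's condition `S_ℓ` : for every prime `p` in the support of `M`,
`depth M_p ≥ min (ℓ, dim M_p)`. -/
def SerreCondition (R : Type u) [CommRing R] (ℓ : ℕ) (M : Type u) [AddCommGroup M]
    [Module R M] : Prop :=
  ∀ p ∈ Module.support R M,
    min ((ℓ : ℕ∞) : WithBot ℕ∞)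
        (moduleDim (Localization.AtPrime p.asIdeal) (LocalizedModule p.asIdeal.primeCompl M)) ≤
      ((moduleDepth (Localization.AtPrime p.asIdeal)
          (IsLocalRing.maximalIdeal (Localization.AtPrime p.asIdeal))
          (LocalizedModule p.asIdeal.primeCompl M) : ℕ∞) : WithBot ℕ∞)

/-- A module `N` over `S` is `J`-cofinite if its support is contained in `V(J)` and all the
modules `Ext^i_S(S/J, N)` are finitely generated. -/
def IsCofinite (S : Type u) [CommRing S] (J : Ideal S) (N : ModuleCat.{u} S) : Prop :=
  Module.support S N ⊆ PrimeSpectrum.zeroLocus (J : Set S) ∧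
  ∀ i : ℕ, Module.Finite S
    (((Ext S (ModuleCat.{u} S) i).obj (Opposite.op (ModuleCat.of S (S ⧸ J)))).obj N)

/-- A ring is catenary if any two saturated chains of primes with the same endpoints have
the same length. -/
def IsCatenaryRing (R : Type u) [CommRing R] : Prop :=
  ∀ c₁ c₂ : LTSeries (PrimeSpectrum R),
    c₁.head = c₂.head → c₁.last = c₂.last →
    (∀ i : Fin c₁.length, c₁.toFun i.castSucc ⋖ c₁.toFun i.succ) →
    (∀ i : Fin c₂.length, c₂.toFun i.castSucc ⋖ c₂.toFun i.succ) →
    c₁.length = c₂.length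

/-- A module is indecomposable if it is nonzero and is not the internal direct sum of two
nonzero submodules. -/
def ModuleIndecomposable (R : Type u) [CommRing R] (M : Type*) [AddCommGroup M]
    [Module R M] : Prop :=
  Nontrivial M ∧ ∀ N₁ N₂ : Submodule R M, IsCompl N₁ N₂ → N₁ = ⊥ ∨ N₂ = ⊥

/-- A module is equidimensional if `dim R/P = dim M` for every minimal prime `P`
of its support (equivalently, of its annihilator). -/
def Equidimensional (R : Type u) [CommRing R] (M : Type*) [AddCommGroup M]
    [Module R M] : Prop :=
  ∀ P ∈ (Module.annihilator R M).minimalPrimes, ringKrullDim (R ⧸ P) = moduleDim R M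

/-- A local ring is Cohen-Macaulay if its depth equals its Krull dimension. -/
def IsCMLocalRing (S : Type u) [CommRing S] [IsLocalRing S] : Prop :=
  ((moduleDepth S (IsLocalRing.maximalIdeal S) S : ℕ∞) : WithBot ℕ∞) = ringKrullDim S

/-- A ring is Cohen-Macaulay if all its localizations at primes are Cohen-Macaulay local
rings. -/
def IsCMRing (S : Type u) [CommRing S] : Prop :=
  ∀ p : PrimeSpectrum S, IsCMLocalRing (Localization.AtPrime p.asIdeal)

/-- `Ext^n_S(X, T)` for modules `X`, `T` over `S`. -/
abbrev ModuleExt (S : Type u) [CommRing S] (X T : Type u) [AddCommGroup X] [Module S X]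
    [AddCommGroup T] [Module S T] (n : ℕ) : Type u :=
  Abelian.Ext (ModuleCat.of S X) (ModuleCat.of S T) n

namespace ModuleExt

variable {S : Type u} [CommRing S]
  {A B C X T : Type u} [AddCommGroup A] [Module S A] [AddCommGroup B] [Module S B]
  [AddCommGroup C] [Module S C] [AddCommGroup X] [Module S X] [AddCommGroup T] [Module S T]

lemma shortExact {f : A →ₗ[S] B} {g : B →ₗ[S] C} (hf : Function.Injective f)
    (hfg : Function.Exact f g) (hg : Function.Surjective g) :
    (ShortComplex.mk (ModuleCat.ofHom f) (ModuleCat.ofHom g) (by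
      ext x; exact hfg.apply_apply_eq_zero x)).ShortExact :=
  { exact := (ShortComplex.ShortExact.moduleCat_exact_iff_function_exact _).2 hfg
    mono_f := (ModuleCat.mono_iff_injective _).2 hf
    epi_g := (ModuleCat.epi_iff_surjective _).2 hg }

/-- The map on `Ext` induced by a map of the second argument. -/
def post (X : Type u) [AddCommGroup X] [Module S X] (f : A →ₗ[S] B) (n : ℕ) :
    ModuleExt S X A n →ₗ[S] ModuleExt S X B n :=
  (Abelian.Ext.mk₀ (ModuleCat.ofHom f)).postcompOfLinear S (ModuleCat.of S X) (add_zero n)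

/-- The map on `Ext` induced by a map of the first argument. -/
def pre (T : Type u) [AddCommGroup T] [Module S T] (f : A →ₗ[S] B) (n : ℕ) :
    ModuleExt S B T n →ₗ[S] ModuleExt S A T n :=
  (Abelian.Ext.mk₀ (ModuleCat.ofHom f)).precompOfLinear S (ModuleCat.of S T) (zero_add n)

lemma post_apply (f : A →ₗ[S] B) (n : ℕ) (e : ModuleExt S X A n) :
    post X f n e = e.comp (Abelian.Ext.mk₀ (ModuleCat.ofHom f)) (add_zero n) := rfl

lemma pre_apply (f : A →ₗ[S] B) (n : ℕ) (e : ModuleExt S B T n) :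
    pre T f n e = (Abelian.Ext.mk₀ (ModuleCat.ofHom f)).comp e (zero_add n) := rfl

lemma post_comp (f : A →ₗ[S] B) (g : B →ₗ[S] C) (n : ℕ) (e : ModuleExt S X A n) :
    post X g n (post X f n e) = post X (g ∘ₗ f) n e := by
  simp only [post_apply, ModuleCat.ofHom_comp, ← Abelian.Ext.mk₀_comp_mk₀]
  rw [Abelian.Ext.comp_assoc_of_third_deg_zero]

lemma pre_comp (f : A →ₗ[S] B) (g : B →ₗ[S] C) (n : ℕ) (e : ModuleExt S C T n) :
    pre T f n (pre T g n e) = pre T (g ∘ₗ f) n e := by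
  simp only [pre_apply, ModuleCat.ofHom_comp, ← Abelian.Ext.mk₀_comp_mk₀]
  rw [Abelian.Ext.comp_assoc_of_second_deg_zero]

lemma post_smul_id (y : S) (n : ℕ) (e : ModuleExt S X A n) :
    post X (y • LinearMap.id) n e = y • e := by
  rw [Abelian.Ext.smul_eq_comp_mk₀]; rfl

lemma pre_smul_id (y : S) (n : ℕ) (e : ModuleExt S A T n) :
    pre T (y • LinearMap.id) n e = y • e := by
  have : (ModuleCat.ofHom (y • LinearMap.id : A →ₗ[S] A)) = y • 𝟙 (ModuleCat.of S A) := rfl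
  rw [pre_apply, this, Abelian.Ext.mk₀_smul, Abelian.Ext.smul_comp, Abelian.Ext.mk₀_id_comp]

lemma post_id (n : ℕ) (e : ModuleExt S X A n) : post X LinearMap.id n e = e := by
  simpa using post_smul_id (1 : S) n e

lemma pre_id (n : ℕ) (e : ModuleExt S A T n) : pre T LinearMap.id n e = e := by
  simpa using pre_smul_id (1 : S) n e

lemma post_zero (n : ℕ) (e : ModuleExt S X A n) : post X (0 : A →ₗ[S] B) n e = 0 := by
  rw [post_apply, ModuleCat.ofHom_zero, Abelian.Ext.mk₀_zero, Abelian.Ext.comp_zero]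

lemma pre_zero (n : ℕ) (e : ModuleExt S B T n) : pre T (0 : A →ₗ[S] B) n e = 0 := by
  rw [pre_apply, ModuleCat.ofHom_zero, Abelian.Ext.mk₀_zero, Abelian.Ext.zero_comp]

lemma smul_eq_zero_of_smul_eq_zero {y : S} (h : ∀ x : X, y • x = 0) {n : ℕ}
    (e : ModuleExt S X T n) : y • e = 0 := by
  rw [← pre_smul_id, show (y • LinearMap.id : X →ₗ[S] X) = 0 from LinearMap.ext h, pre_zero]

section LES

variable {f : A →ₗ[S] B} {g : B →ₗ[S] C} (hf : Function.Injective f)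
    (hfg : Function.Exact f g) (hg : Function.Surjective g)
include hf hfg hg

/-- The covariant connecting map. -/
def postδ (X : Type u) [AddCommGroup X] [Module S X] (n : ℕ) :
    ModuleExt S X C n →ₗ[S] ModuleExt S X A (n + 1) :=
  (shortExact hf hfg hg).extClass.postcompOfLinear S (ModuleCat.of S X) rfl

/-- The contravariant connecting map. -/
def preδ (T : Type u) [AddCommGroup T] [Module S T] (n : ℕ) :
    ModuleExt S A T n →ₗ[S] ModuleExt S C T (n + 1) :=
  (shortExact hf hfg hg).extClass.precompOfLinear S (ModuleCat.of S T) (add_comm 1 n)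

lemma post_exact (n : ℕ) : Function.Exact (post X f n) (post X g n) := fun e ↦ by
  refine ⟨fun h ↦ Abelian.Ext.covariant_sequence_exact₂ _ (shortExact hf hfg hg) e h, ?_⟩
  rintro ⟨e, rfl⟩
  rw [post_comp, hfg.linearMap_comp_eq_zero, post_zero]

lemma post_postδ_exact (n : ℕ) : Function.Exact (post X g n) (postδ hf hfg hg X n) := fun e ↦ by
  refine ⟨fun h ↦ Abelian.Ext.covariant_sequence_exact₃ _ (shortExact hf hfg hg) e rfl h, ?_⟩
  rintro ⟨e, rfl⟩
  change (e.comp (Abelian.Ext.mk₀ (ModuleCat.ofHom g)) (add_zero n)).comp (shortExact hf hfg hg).extClass rfl = 0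
  rw [Abelian.Ext.comp_assoc_of_second_deg_zero]
  exact (congr_arg (fun t ↦ e.comp t (rfl : n + 1 = n + 1)) (shortExact hf hfg hg).comp_extClass).trans
    (Abelian.Ext.comp_zero ..)

lemma postδ_post_exact (n : ℕ) : Function.Exact (postδ hf hfg hg X n) (post X f (n + 1)) :=
    fun e ↦ by
  refine ⟨fun h ↦ Abelian.Ext.covariant_sequence_exact₁ _ (shortExact hf hfg hg) e h rfl, ?_⟩
  rintro ⟨e, rfl⟩
  change (e.comp (shortExact hf hfg hg).extClass rfl).comp (Abelian.Ext.mk₀ (ModuleCat.ofHom f)) (add_zero (n + 1)) = 0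
  rw [Abelian.Ext.comp_assoc_of_third_deg_zero]
  exact (congr_arg (fun t ↦ e.comp t (rfl : n + 1 = n + 1)) (shortExact hf hfg hg).extClass_comp).trans
    (Abelian.Ext.comp_zero ..)

lemma pre_exact (n : ℕ) : Function.Exact (pre T g n) (pre T f n) := fun e ↦ by
  refine ⟨fun h ↦ Abelian.Ext.contravariant_sequence_exact₂ (shortExact hf hfg hg) _ e h, ?_⟩
  rintro ⟨e, rfl⟩
  rw [pre_comp, hfg.linearMap_comp_eq_zero, pre_zero]

lemma preδ_pre_exact (n : ℕ) : Function.Exact (preδ hf hfg hg T n) (pre T g (n + 1)) :=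
    fun e ↦ by
  refine ⟨fun h ↦ Abelian.Ext.contravariant_sequence_exact₃ (shortExact hf hfg hg) _ e h
    (add_comm 1 n), ?_⟩
  rintro ⟨e, rfl⟩
  change (Abelian.Ext.mk₀ (ModuleCat.ofHom g)).comp ((shortExact hf hfg hg).extClass.comp e (add_comm 1 n)) (zero_add (n + 1)) = 0
  rw [← Abelian.Ext.comp_assoc _ _ _ (zero_add 1) (add_comm 1 n) (by omega)]
  exact (congr_arg (fun t ↦ Abelian.Ext.comp t e (add_comm 1 n)) (shortExact hf hfg hg).comp_extClass).trans
    (Abelian.Ext.zero_comp ..)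

lemma post_zero_injective : Function.Injective (post X f 0) := by
  have := (shortExact hf hfg hg).mono_f
  exact Abelian.Ext.postcomp_mk₀_injective_of_mono _ _

lemma pre_zero_injective : Function.Injective (pre T g 0) := by
  have := (shortExact hf hfg hg).epi_g
  exact Abelian.Ext.precomp_mk₀_injective_of_epi _ _

lemma noeth_post_mid {n : ℕ} (hA : IsNoetherian S (ModuleExt S X A n))
    (hC : IsNoetherian S (ModuleExt S X C n)) : IsNoetherian S (ModuleExt S X B n) :=
  isNoetherian_of_range_eq_ker _ _ (post_exact hf hfg hg n).linearMap_ker_eq.symm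

lemma noeth_post_right {n : ℕ} (hB : IsNoetherian S (ModuleExt S X B n))
    (hA : IsNoetherian S (ModuleExt S X A (n + 1))) : IsNoetherian S (ModuleExt S X C n) :=
  isNoetherian_of_range_eq_ker _ _ (post_postδ_exact hf hfg hg n).linearMap_ker_eq.symm

lemma noeth_post_left {n : ℕ} (hC : IsNoetherian S (ModuleExt S X C n))
    (hB : IsNoetherian S (ModuleExt S X B (n + 1))) : IsNoetherian S (ModuleExt S X A (n + 1)) :=
  isNoetherian_of_range_eq_ker _ _ (postδ_post_exact hf hfg hg n).linearMap_ker_eq.symm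

lemma noeth_post_left_zero (hB : IsNoetherian S (ModuleExt S X B 0)) :
    IsNoetherian S (ModuleExt S X A 0) :=
  isNoetherian_of_injective _ (post_zero_injective hf hfg hg)

lemma noeth_pre_mid {n : ℕ} (hA : IsNoetherian S (ModuleExt S A T n))
    (hC : IsNoetherian S (ModuleExt S C T n)) : IsNoetherian S (ModuleExt S B T n) :=
  isNoetherian_of_range_eq_ker _ _ (pre_exact hf hfg hg n).linearMap_ker_eq.symm

lemma noeth_pre_right {n : ℕ} (hA : IsNoetherian S (ModuleExt S A T n))
    (hB : IsNoetherian S (ModuleExt S B T (n + 1))) : IsNoetherian S (ModuleExt S C T (n + 1)) :=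
  isNoetherian_of_range_eq_ker _ _ (preδ_pre_exact hf hfg hg n).linearMap_ker_eq.symm

lemma noeth_pre_right_zero (hB : IsNoetherian S (ModuleExt S B T 0)) :
    IsNoetherian S (ModuleExt S C T 0) :=
  isNoetherian_of_injective _ (pre_zero_injective hf hfg hg)

end LES

lemma subsingleton_of_injective [CategoryTheory.Injective (ModuleCat.of S T)] (n : ℕ) :
    Subsingleton (ModuleExt S X T (n + 1)) :=
  ⟨fun a b ↦ by rw [a.eq_zero_of_injective, b.eq_zero_of_injective]⟩

lemma subsingleton_of_projective [CategoryTheory.Projective (ModuleCat.of S X)] (n : ℕ) :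
    Subsingleton (ModuleExt S X T (n + 1)) :=
  ⟨fun a b ↦ by rw [a.eq_zero_of_projective, b.eq_zero_of_projective]⟩

lemma isNoetherian_of_finite [IsNoetherianRing S] [Module.Finite S X] [Module.Finite S T] (n : ℕ) :
    IsNoetherian S (ModuleExt S X T n) := by
  have := ModuleCat.finite_ext S (ModuleCat.of S X) (ModuleCat.of S T) n
  exact isNoetherian_of_isNoetherianRing_of_finite S _

/-- `Ext⁰` is `Hom`. -/
def zeroEquiv : ModuleExt S X T 0 ≃ₗ[S] (X →ₗ[S] T) :=
  (Abelian.Ext.linearEquiv₀ (R := S)).trans ModuleCat.homLinearEquiv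

/-- `Ext` along an isomorphism of the second argument. -/
def postEquiv (X : Type u) [AddCommGroup X] [Module S X] (e : A ≃ₗ[S] B) (n : ℕ) :
    ModuleExt S X A n ≃ₗ[S] ModuleExt S X B n :=
  LinearEquiv.ofLinearMap (post X e.toLinearMap n) (post X e.symm.toLinearMap n)
    (by ext a; simp [post_comp, post_id]) (by ext a; simp [post_comp, post_id])

/-- `Ext` along an isomorphism of the first argument. -/
def preEquiv (T : Type u) [AddCommGroup T] [Module S T] (e : A ≃ₗ[S] B) (n : ℕ) :
    ModuleExt S B T n ≃ₗ[S] ModuleExt S A T n :=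
  LinearEquiv.ofLinearMap (pre T e.toLinearMap n) (pre T e.symm.toLinearMap n)
    (by ext a; simp [pre_comp, pre_id]) (by ext a; simp [pre_comp, pre_id])

end ModuleExt

/-- A module all of whose elements are killed by some power of `J`. -/
def IsPowTorsion {S : Type*} [CommRing S] (J : Ideal S) (T : Type*) [AddCommGroup T]
    [Module S T] : Prop :=
  ∀ t : T, ∃ n : ℕ, ∀ a ∈ J ^ n, a • t = 0

/-- All the modules `Ext^j(S/J, T)` are finitely generated. -/
def ExtFinite {S : Type u} [CommRing S] (J : Ideal S) (T : Type u) [AddCommGroup T]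
    [Module S T] : Prop :=
  ∀ j : ℕ, IsNoetherian S (ModuleExt S (S ⧸ J) T j)

/-- For `J`-torsion modules `T`, finiteness of `Ext^0(S/J, T)` and `Ext^1(S/J, T)` implies
finiteness of all `Ext^j(S/J, T)`. -/
def ExtFiniteOfLow {S : Type u} [CommRing S] (J : Ideal S) : Prop :=
  ∀ (T : Type u) [AddCommGroup T] [Module S T], IsPowTorsion J T →
    IsNoetherian S (ModuleExt S (S ⧸ J) T 0) → IsNoetherian S (ModuleExt S (S ⧸ J) T 1) →
    ExtFinite J T

section

variable {S : Type u} [CommRing S] {J : Ideal S}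
  {T : Type u} [AddCommGroup T] [Module S T]

lemma IsPowTorsion.of_injective {A B : Type*} [AddCommGroup A] [Module S A] [AddCommGroup B]
    [Module S B] (f : A →ₗ[S] B) (hf : Function.Injective f) (h : IsPowTorsion J B) :
    IsPowTorsion J A := fun t ↦ by
  obtain ⟨n, hn⟩ := h (f t)
  exact ⟨n, fun a ha ↦ hf (by simp [hn a ha])⟩

lemma IsPowTorsion.of_surjective {A B : Type*} [AddCommGroup A] [Module S A] [AddCommGroup B]
    [Module S B] (f : A →ₗ[S] B) (hf : Function.Surjective f) (h : IsPowTorsion J A) :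
    IsPowTorsion J B := fun t ↦ by
  obtain ⟨t, rfl⟩ := hf t
  obtain ⟨n, hn⟩ := h t
  exact ⟨n, fun a ha ↦ by rw [← map_smul, hn a ha, map_zero]⟩

lemma IsPowTorsion.of_le_radical [IsNoetherianRing S] {J' : Ideal S} {T : Type*} [AddCommGroup T]
    [Module S T] (hJ : J' ≤ J.radical) (h : IsPowTorsion J T) : IsPowTorsion J' T := fun t ↦ by
  obtain ⟨n, hn⟩ := h t
  obtain ⟨k, hk⟩ := Ideal.exists_pow_le_of_le_radical_of_fg hJ (IsNoetherian.noetherian J')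
  exact ⟨k * n, fun a ha ↦ hn a (Ideal.pow_right_mono hk n (by rwa [← pow_mul]))⟩

lemma IsPowTorsion.exists_pow_smul_eq_zero [Module.Finite S T] (h : IsPowTorsion J T) :
    ∃ n : ℕ, ∀ a ∈ J ^ n, ∀ t : T, a • t = 0 := by
  obtain ⟨s, hs⟩ := Module.Finite.fg_top (R := S) (M := T)
  choose k hk using h
  refine ⟨s.sup k, fun a ha t ↦ ?_⟩
  have : t ∈ Submodule.span S (s : Set T) := hs ▸ trivial
  induction this using Submodule.span_induction with
  | mem x hx => exact hk x a (Ideal.pow_le_pow_right (Finset.le_sup hx) ha)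
  | zero => simp
  | add x y _ _ hx hy => rw [smul_add, hx, hy, add_zero]
  | smul b x _ hx => rw [smul_comm, hx, smul_zero]

lemma isNoetherian_ext_of_le_radical_annihilator [IsNoetherianRing S] {n : ℕ}
    (h : ∀ j ≤ n, IsNoetherian S (ModuleExt S (S ⧸ J) T j)) :
    ∀ j ≤ n, ∀ (X : Type u) [AddCommGroup X] [Module S X] [Module.Finite S X],
      J ≤ (Module.annihilator S X).radical → IsNoetherian S (ModuleExt S X T j) := by
  intro j
  induction j with
  | zero =>
    intro hj X _ _ hfin
    induction hfin using IsNoetherianRing.induction_on_isQuotientEquivQuotientPrime with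
    | subsingleton N =>
      intro _
      have : Subsingleton (ModuleExt S N T 0) :=
        (ModuleExt.zeroEquiv (S := S) (X := N) (T := T)).toEquiv.subsingleton
      infer_instance
    | quotient N p e =>
      intro hN
      rw [e.annihilator_eq, Ideal.annihilator_quotient, p.2.radical] at hN
      have := h 0 hj
      have h1 := ModuleExt.noeth_pre_right_zero (T := T)
        (Submodule.subtype_injective _) (LinearMap.exact_subtype_ker_map
        (Submodule.factor (p := J) (p' := p.asIdeal) hN)) (Submodule.factor_surjective hN) this
      exact isNoetherian_of_linearEquiv (ModuleExt.preEquiv T e 0)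
    | exact N₁ N₂ N₃ f g hf hg hfg h₁ h₃ =>
      intro hN
      exact ModuleExt.noeth_pre_mid hf hfg hg
        (h₁ (hN.trans (Ideal.radical_mono (f.annihilator_le_of_injective hf))))
        (h₃ (hN.trans (Ideal.radical_mono (g.annihilator_le_of_surjective hg))))
  | succ j ih =>
    intro hj X _ _ hfin
    induction hfin using IsNoetherianRing.induction_on_isQuotientEquivQuotientPrime with
    | subsingleton N =>
      intro _
      have := ModuleExt.smul_eq_zero_of_smul_eq_zero (X := N) (T := T) (y := (1 : S))
        (fun x ↦ Subsingleton.elim _ _) (n := j + 1)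
      have : Subsingleton (ModuleExt S N T (j + 1)) :=
        subsingleton_of_forall_eq 0 fun e ↦ by simpa using this e
      infer_instance
    | quotient N p e =>
      intro hN
      rw [e.annihilator_eq, Ideal.annihilator_quotient, p.2.radical] at hN
      have h2 := h (j + 1) hj
      have h1 := ModuleExt.noeth_pre_right (T := T)
        (Submodule.subtype_injective _) (LinearMap.exact_subtype_ker_map
        (Submodule.factor (p := J) (p' := p.asIdeal) hN)) (Submodule.factor_surjective hN)
        (ih (by omega) _ ((Ideal.annihilator_quotient (I := J)).ge.trans
          ((LinearMap.annihilator_le_of_injective _ (Submodule.subtype_injective _)).trans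
            Ideal.le_radical))) h2
      exact isNoetherian_of_linearEquiv (ModuleExt.preEquiv T e (j + 1))
    | exact N₁ N₂ N₃ f g hf hg hfg h₁ h₃ =>
      intro hN
      exact ModuleExt.noeth_pre_mid hf hfg hg
        (h₁ (hN.trans (Ideal.radical_mono (f.annihilator_le_of_injective hf))))
        (h₃ (hN.trans (Ideal.radical_mono (g.annihilator_le_of_surjective hg))))

lemma ExtFinite.of_le_radical [IsNoetherianRing S] {J' : Ideal S} (hJ : J ≤ J'.radical)
    (h : ExtFinite J T) : ExtFinite J' T := fun j ↦
  isNoetherian_ext_of_le_radical_annihilator (fun i _ ↦ h i) j le_rfl _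
    (by rwa [Ideal.annihilator_quotient])

lemma ExtFiniteOfLow.of_radical_eq [IsNoetherianRing S] {J' : Ideal S}
    (hJ : J.radical = J'.radical) (h : ExtFiniteOfLow J) : ExtFiniteOfLow J' := by
  intro T _ _ hT h0 h1
  have h2 : ∀ j ≤ 1, IsNoetherian S (ModuleExt S (S ⧸ J') T j) := by
    intro j hj; interval_cases j <;> assumption
  have h3 := fun j hj ↦ isNoetherian_ext_of_le_radical_annihilator h2 j hj (S ⧸ J)
    (by rw [Ideal.annihilator_quotient, hJ]; exact Ideal.le_radical)
  refine (h T (hT.of_le_radical (hJ ▸ Ideal.le_radical)) (h3 0 (by simp)) (h3 1 le_rfl)).of_le_radical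
    (hJ ▸ Ideal.le_radical)

lemma IsPowTorsion.ext [IsNoetherianRing S] (hT : IsPowTorsion J T) (k : ℕ) :
    ∀ (X : Type u) [AddCommGroup X] [Module S X] [Module.Finite S X],
      IsPowTorsion J (ModuleExt S X T k) := by
  induction k with
  | zero =>
    intro X _ _ _
    refine .of_injective ModuleExt.zeroEquiv.toLinearMap ModuleExt.zeroEquiv.injective fun f ↦ ?_
    obtain ⟨n, hn⟩ := (hT.of_injective (LinearMap.range f).subtype
      (Submodule.subtype_injective _)).exists_pow_smul_eq_zero
    refine ⟨n, fun a ha ↦ LinearMap.ext fun x ↦ ?_⟩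
    exact congr_arg Subtype.val (hn a ha ⟨f x, ⟨x, rfl⟩⟩)
  | succ k ih =>
    intro X _ _ _
    obtain ⟨m, g, hg⟩ := Module.Finite.exists_fin' S X
    obtain ⟨g, hg⟩ : ∃ g : (ULift.{u} (Fin m) → S) →ₗ[S] X, Function.Surjective g :=
      ⟨g ∘ₗ (LinearEquiv.funCongrLeft S S Equiv.ulift.symm).toLinearMap,
        hg.comp (LinearEquiv.surjective _)⟩
    have := (IsProjective.iff_projective (R := S) (ULift.{u} (Fin m) → S)).1 inferInstance
    have := ModuleExt.subsingleton_of_projective (S := S) (X := ULift.{u} (Fin m) → S) (T := T) k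
    refine (ih (LinearMap.ker g)).of_surjective (ModuleExt.preδ (Submodule.subtype_injective _)
      (LinearMap.exact_subtype_ker_map g) hg T k) fun e ↦ ?_
    exact (ModuleExt.preδ_pre_exact _ _ _ _ e).1 (Subsingleton.elim _ _)

lemma IsPowTorsion.subsingleton_ext [IsNoetherianRing S] {I : Ideal S} (hIJ : I ⊔ J = ⊤)
    (hT : IsPowTorsion J T) {X : Type u} [AddCommGroup X] [Module S X] [Module.Finite S X]
    (hX : ∀ a ∈ I, ∀ x : X, a • x = 0) (k : ℕ) : Subsingleton (ModuleExt S X T k) := by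
  refine subsingleton_of_forall_eq 0 fun e ↦ ?_
  obtain ⟨n, hn⟩ := hT.ext k X e
  have h1 : I ⊔ J ^ n = ⊤ := Ideal.sup_pow_eq_top hIJ
  obtain ⟨a, ha, b, hb, hab⟩ := Submodule.mem_sup.1 ((Ideal.eq_top_iff_one _).1 h1)
  rw [← one_smul S e, ← hab, add_smul, hn b hb,
    ModuleExt.smul_eq_zero_of_smul_eq_zero (hX a ha), add_zero]

lemma isNoetherian_ker_post {A B C X : Type u} [AddCommGroup A] [Module S A] [AddCommGroup B]
    [Module S B] [AddCommGroup C] [Module S C] [AddCommGroup X] [Module S X]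
    {f : A →ₗ[S] B} {g : B →ₗ[S] C} (hf : Function.Injective f)
    (hfg : Function.Exact f g) (hg : Function.Surjective g) (j : ℕ)
    (h : ∀ i, i + 1 = j → IsNoetherian S (ModuleExt S X C i)) :
    IsNoetherian S (LinearMap.ker (ModuleExt.post X f j)) := by
  cases j with
  | zero =>
    rw [LinearMap.ker_eq_bot.2 (ModuleExt.post_zero_injective hf hfg hg)]
    infer_instance
  | succ i =>
    have := h i rfl
    rw [(ModuleExt.postδ_post_exact hf hfg hg i).linearMap_ker_eq]
    infer_instance

variable (T) in
/-- Multiplication by `y`. -/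
abbrev smulMap (y : S) : T →ₗ[S] T := LinearMap.lsmul S T y

lemma exact_ker_rangeRestrict (f : T →ₗ[S] T) :
    Function.Exact (LinearMap.ker f).subtype f.rangeRestrict := by
  rw [LinearMap.exact_iff, Submodule.range_subtype, LinearMap.ker_rangeRestrict]

lemma isNoetherian_ext_of_smulMap {X : Type u} [AddCommGroup X] [Module S X] {y : S}
    (hX : ∀ x : X, y • x = 0) (j : ℕ)
    (hK : IsNoetherian S (ModuleExt S X (LinearMap.ker (smulMap T y)) j))
    (hQ : ∀ i, i + 1 = j → IsNoetherian S (ModuleExt S X (T ⧸ LinearMap.range (smulMap T y)) i)) :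
    IsNoetherian S (ModuleExt S X T j) := by
  set f := smulMap T y
  have h1 := isNoetherian_ker_post (X := X) (Submodule.subtype_injective _)
    (LinearMap.exact_subtype_mkQ (LinearMap.range f)) (Submodule.mkQ_surjective _) j hQ
  let a := ModuleExt.post X f.rangeRestrict j
  have ha : ∀ e, a e ∈ LinearMap.ker (ModuleExt.post X (LinearMap.range f).subtype j) := by
    intro e
    rw [LinearMap.mem_ker, ModuleExt.post_comp, LinearMap.subtype_comp_codRestrict]
    exact (ModuleExt.post_smul_id y j e).trans (ModuleExt.smul_eq_zero_of_smul_eq_zero hX e)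
  refine isNoetherian_of_range_eq_ker (ModuleExt.post X (LinearMap.ker f).subtype j)
    (a.codRestrict _ ha) ?_
  rw [LinearMap.ker_codRestrict]
  exact (ModuleExt.post_exact (Submodule.subtype_injective _) (exact_ker_rangeRestrict f)
    f.surjective_rangeRestrict j).linearMap_ker_eq.symm

lemma smul_quotient_eq_zero {y : S} (hy : y ∈ J) (x : S ⧸ J) : y • x = 0 := by
  obtain ⟨x, rfl⟩ := Ideal.Quotient.mk_surjective x
  rw [Algebra.smul_def, Ideal.Quotient.algebraMap_eq, Ideal.Quotient.eq_zero_iff_mem.2 hy, zero_mul]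

lemma ExtFinite.of_smulMap {y : S} (hy : y ∈ J)
    (hK : ExtFinite J (LinearMap.ker (smulMap T y)))
    (hQ : ExtFinite J (T ⧸ LinearMap.range (smulMap T y))) : ExtFinite J T := fun j ↦
  isNoetherian_ext_of_smulMap (fun x ↦ smul_quotient_eq_zero hy x) j (hK j) (fun i _ ↦ hQ i)

lemma isNoetherian_ext_ker {X : Type u} [AddCommGroup X] [Module S X] (f : T →ₗ[S] T)
    (h0 : IsNoetherian S (ModuleExt S X T 0)) :
    IsNoetherian S (ModuleExt S X (LinearMap.ker f) 0) :=
  ModuleExt.noeth_post_left_zero (Submodule.subtype_injective _) (exact_ker_rangeRestrict f)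
    f.surjective_rangeRestrict h0

lemma isNoetherian_ext_ker_one {X : Type u} [AddCommGroup X] [Module S X] (f : T →ₗ[S] T)
    (h0 : IsNoetherian S (ModuleExt S X T 0)) (h1 : IsNoetherian S (ModuleExt S X T 1)) :
    IsNoetherian S (ModuleExt S X (LinearMap.ker f) 1) :=
  ModuleExt.noeth_post_left (Submodule.subtype_injective _) (exact_ker_rangeRestrict f)
    f.surjective_rangeRestrict (ModuleExt.noeth_post_left_zero (Submodule.subtype_injective _)
    (LinearMap.exact_subtype_mkQ (LinearMap.range f)) (Submodule.mkQ_surjective _) h0) h1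

lemma isNoetherian_ext_coker {X : Type u} [AddCommGroup X] [Module S X] (f : T →ₗ[S] T) (j : ℕ)
    (h0 : IsNoetherian S (ModuleExt S X T j)) (h1 : IsNoetherian S (ModuleExt S X T (j + 1)))
    (hK : IsNoetherian S (ModuleExt S X (LinearMap.ker f) (j + 2))) :
    IsNoetherian S (ModuleExt S X (T ⧸ LinearMap.range f) j) :=
  ModuleExt.noeth_post_right (Submodule.subtype_injective _)
    (LinearMap.exact_subtype_mkQ (LinearMap.range f)) (Submodule.mkQ_surjective _) h0
    (ModuleExt.noeth_post_right (Submodule.subtype_injective _) (exact_ker_rangeRestrict f)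
      f.surjective_rangeRestrict h1 hK)

end

/-- The submodule of elements killed by some power of `J`. -/
def powTorsion {S : Type*} [CommRing S] (J : Ideal S) (T : Type*) [AddCommGroup T]
    [Module S T] : Submodule S T where
  carrier := {t | ∃ n : ℕ, ∀ a ∈ J ^ n, a • t = 0}
  zero_mem' := ⟨0, by simp⟩
  add_mem' := by
    rintro s t ⟨n, hn⟩ ⟨m, hm⟩
    refine ⟨max n m, fun a ha ↦ ?_⟩
    rw [smul_add, hn a (Ideal.pow_le_pow_right (le_max_left _ _) ha),
      hm a (Ideal.pow_le_pow_right (le_max_right _ _) ha), add_zero]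
  smul_mem' := by
    rintro b t ⟨n, hn⟩
    exact ⟨n, fun a ha ↦ by rw [smul_comm, hn a ha, smul_zero]⟩

section

variable {S : Type u} [CommRing S] {J : Ideal S}
  {T : Type u} [AddCommGroup T] [Module S T]

lemma mem_powTorsion {S : Type*} [CommRing S] {J : Ideal S} {T : Type*} [AddCommGroup T]
    [Module S T] {t : T} : t ∈ powTorsion J T ↔ ∃ n : ℕ, ∀ a ∈ J ^ n, a • t = 0 := Iff.rfl

lemma isPowTorsion_powTorsion {S : Type*} [CommRing S] (J : Ideal S) (T : Type*) [AddCommGroup T]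
    [Module S T] : IsPowTorsion J (powTorsion J T) := fun t ↦ by
  obtain ⟨n, hn⟩ := t.2
  exact ⟨n, fun a ha ↦ Subtype.ext (hn a ha)⟩

lemma isNoetherian_torsionBySet
    (h : IsNoetherian S (ModuleExt S (S ⧸ J) T 0)) :
    IsNoetherian S (Submodule.torsionBySet S T J) := by
  have := isNoetherian_of_linearEquiv (ModuleExt.zeroEquiv (S := S) (X := S ⧸ J) (T := T))
  let φ : Submodule.torsionBySet S T J →ₗ[S] ((S ⧸ J) →ₗ[S] T) :=
    { toFun t := Submodule.liftQ J (LinearMap.toSpanSingleton S T t) fun a ha ↦ by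
        simpa using (Submodule.mem_torsionBySet_iff _ _).1 t.2 ⟨a, ha⟩
      map_add' s t := Submodule.linearMap_qext _ (by ext; exact smul_add (1 : S) (s : T) t)
      map_smul' a t := Submodule.linearMap_qext _ (by ext; exact smul_comm (1 : S) a (t : T)) }
  refine isNoetherian_of_injective φ fun s t h ↦ Subtype.ext ?_
  have h1 : (1 : S) • (s : T) = (1 : S) • (t : T) :=
    LinearMap.congr_fun h (Submodule.Quotient.mk 1)
  rwa [one_smul, one_smul] at h1

lemma isNoetherian_ext_zero (h : IsNoetherian S (Submodule.torsionBySet S T J)) :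
    IsNoetherian S (ModuleExt S (S ⧸ J) T 0) := by
  have : IsNoetherian S ((S ⧸ J) →ₗ[S] T) := by
    let φ : ((S ⧸ J) →ₗ[S] T) →ₗ[S] Submodule.torsionBySet S T J :=
      (LinearMap.applyₗ (1 : S ⧸ J)).codRestrict _ fun f ↦ by
        rw [Submodule.mem_torsionBySet_iff]
        intro a
        change (a : S) • f 1 = 0
        rw [← map_smul, smul_quotient_eq_zero a.2, map_zero]
    refine isNoetherian_of_injective φ fun f g h ↦ ?_
    have h1 : f 1 = g 1 := congr_arg Subtype.val h
    ext
    exact h1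
  exact isNoetherian_of_linearEquiv (ModuleExt.zeroEquiv (S := S) (X := S ⧸ J) (T := T)).symm

lemma isNoetherian_torsionBySet_pow [IsNoetherianRing S]
    (h : IsNoetherian S (ModuleExt S (S ⧸ J) T 0)) (m : ℕ) :
    IsNoetherian S (Submodule.torsionBySet S T (J ^ m : Ideal S)) :=
  isNoetherian_torsionBySet (isNoetherian_ext_of_le_radical_annihilator (J := J) (n := 0)
    (fun j hj ↦ by obtain rfl : j = 0 := by omega
                   exact h) 0 le_rfl _ (by
    rw [Ideal.annihilator_quotient]
    exact fun a ha ↦ ⟨m, Ideal.pow_mem_pow ha m⟩))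

lemma isNoetherian_of_ext_zero [IsNoetherianRing S] (hT : ∃ n : ℕ, ∀ a ∈ J ^ n, ∀ t : T, a • t = 0)
    (h : IsNoetherian S (ModuleExt S (S ⧸ J) T 0)) : IsNoetherian S T := by
  obtain ⟨n, hn⟩ := hT
  have := isNoetherian_torsionBySet_pow h n
  refine isNoetherian_of_injective (LinearMap.id.codRestrict
    (Submodule.torsionBySet S T (J ^ n : Ideal S)) fun t ↦ ?_) fun s t h ↦ congr_arg Subtype.val h
  rw [Submodule.mem_torsionBySet_iff]
  exact fun a ↦ hn a a.2 t

lemma extFinite_of_isNoetherian [IsNoetherianRing S] (J : Ideal S) (h : IsNoetherian S T) :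
    ExtFinite J T := fun j ↦ ModuleExt.isNoetherian_of_finite j

lemma extFiniteOfLow_span_singleton [IsNoetherianRing S] (f : S) :
    ExtFiniteOfLow (Ideal.span {f}) := by
  intro T _ _ _ h0 h1
  have hf : f ∈ Ideal.span {f} := Ideal.mem_span_singleton_self f
  have hK : ExtFinite (Ideal.span {f}) (LinearMap.ker (smulMap T f)) := by
    refine extFinite_of_isNoetherian _ (isNoetherian_of_ext_zero ⟨1, fun a ha t ↦ ?_⟩
      (isNoetherian_ext_ker _ h0))
    obtain ⟨b, rfl⟩ := Ideal.mem_span_singleton'.1 (by simpa using ha)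
    rw [mul_smul, show f • t = 0 from Subtype.ext t.2, smul_zero]
  refine .of_smulMap hf hK (extFinite_of_isNoetherian _ (isNoetherian_of_ext_zero
    ⟨1, fun a ha t ↦ ?_⟩ (isNoetherian_ext_coker _ 0 h0 h1 (hK 2))))
  obtain ⟨b, rfl⟩ := Ideal.mem_span_singleton'.1 (by simpa using ha)
  obtain ⟨t, rfl⟩ := Submodule.mkQ_surjective _ t
  rw [← map_smul, mul_smul, smul_comm]
  exact (Submodule.Quotient.mk_eq_zero _).2 ⟨b • t, rfl⟩

lemma isPowTorsion_quotient_powTorsion [IsNoetherianRing S] {I : Ideal S}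
    (hT : IsPowTorsion (I * J) T) : IsPowTorsion J (T ⧸ powTorsion I T) := fun t ↦ by
  obtain ⟨t, rfl⟩ := Submodule.mkQ_surjective _ t
  obtain ⟨n, hn⟩ := hT t
  refine ⟨n, fun a ha ↦ ?_⟩
  rw [← map_smul]
  refine (Submodule.Quotient.mk_eq_zero _).2 ⟨n, fun b hb ↦ ?_⟩
  rw [smul_smul]
  exact hn _ (by rw [mul_pow]; exact Ideal.mul_mem_mul hb ha)

lemma isNoetherian_ext_of_coprime [IsNoetherianRing S] {I : Ideal S} (hIJ : I ⊔ J = ⊤)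
    (hI : ExtFiniteOfLow I) (hT : IsPowTorsion (I * J) T)
    (h0 : IsNoetherian S (ModuleExt S (S ⧸ (I * J)) T 0))
    (h1 : IsNoetherian S (ModuleExt S (S ⧸ (I * J)) T 1)) : ExtFinite I T := by
  have h2 : ∀ j ≤ 1, IsNoetherian S (ModuleExt S (S ⧸ (I * J)) T j) := by
    intro j hj; interval_cases j <;> assumption
  have h3 := fun j hj ↦ isNoetherian_ext_of_le_radical_annihilator h2 j hj (S ⧸ I)
    (by rw [Ideal.annihilator_quotient]; exact Ideal.mul_le_left.trans Ideal.le_radical)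
  have h4 (k : ℕ) : Subsingleton (ModuleExt S (S ⧸ I) (T ⧸ powTorsion I T) k) :=
    (isPowTorsion_quotient_powTorsion hT).subsingleton_ext hIJ
      (fun a ha x ↦ smul_quotient_eq_zero ha x) k
  have h5 : ExtFinite I (powTorsion I T) := by
    refine hI _ (isPowTorsion_powTorsion I T) ?_ ?_
    · exact ModuleExt.noeth_post_left_zero (Submodule.subtype_injective _)
        (LinearMap.exact_subtype_mkQ _) (Submodule.mkQ_surjective _) (h3 0 (by simp))
    · exact ModuleExt.noeth_post_left (Submodule.subtype_injective _)
        (LinearMap.exact_subtype_mkQ _) (Submodule.mkQ_surjective _) inferInstance (h3 1 le_rfl)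
  exact fun j ↦ ModuleExt.noeth_post_mid (Submodule.subtype_injective _)
        (LinearMap.exact_subtype_mkQ _) (Submodule.mkQ_surjective _) (h5 j) inferInstance

lemma ExtFiniteOfLow.mul [IsNoetherianRing S] {I : Ideal S} (hIJ : I ⊔ J = ⊤)
    (hI : ExtFiniteOfLow I) (hJ : ExtFiniteOfLow J) : ExtFiniteOfLow (I * J) := by
  intro T _ _ hT h0 h1 k
  have h2 := isNoetherian_ext_of_coprime hIJ hI hT h0 h1
  have h3 := isNoetherian_ext_of_coprime (I := J) (J := I) (T := T) (by rwa [sup_comm]) hJ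
    (by rwa [mul_comm]) (by rwa [mul_comm]) (by rwa [mul_comm])
  have hle : I * J ≤ I := Ideal.mul_le_left
  refine ModuleExt.noeth_pre_mid (Submodule.subtype_injective _) (LinearMap.exact_subtype_ker_map
    (Submodule.factor hle)) (Submodule.factor_surjective hle) ?_ (h2 k)
  refine isNoetherian_ext_of_le_radical_annihilator (J := J) (n := k) (fun j _ ↦ h3 j) k le_rfl _
    (le_trans (fun a ha ↦ ?_) Ideal.le_radical)
  rw [Module.mem_annihilator]
  rintro ⟨x, hx⟩
  obtain ⟨x, rfl⟩ := Submodule.mkQ_surjective _ x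
  refine Subtype.ext ?_
  have hx' : x ∈ I := (Submodule.Quotient.mk_eq_zero _).1 hx
  change a • Submodule.mkQ _ x = 0
  rw [← map_smul]
  exact (Submodule.Quotient.mk_eq_zero _).2 (by
    rw [smul_eq_mul, mul_comm a x]; exact Ideal.mul_mem_mul hx' ha)

end

section

variable {S : Type u} [CommRing S] {J : Ideal S}
  {T : Type u} [AddCommGroup T] [Module S T]

/-- The elements of the form `x ^ n • t` with `t ∈ N` and `x ^ (n + 1) • t = 0`. -/
def powSocle (x : S) (n : ℕ) (N : Submodule S T) : Submodule S T :=
  (N ⊓ LinearMap.ker (smulMap T (x ^ (n + 1)))).map (smulMap T (x ^ n))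

lemma powSocle_le_ker (x : S) (n : ℕ) (N : Submodule S T) :
    powSocle x n N ≤ LinearMap.ker (smulMap T x) := by
  rintro _ ⟨t, ⟨-, ht⟩, rfl⟩
  change x • x ^ n • t = 0
  rw [smul_smul, ← pow_succ']
  exact ht

lemma powSocle_mono (x : S) {n m : ℕ} (hnm : n ≤ m) {N N' : Submodule S T} (hN : N ≤ N') :
    powSocle x m N ≤ powSocle x n N' := by
  rintro _ ⟨t, ⟨ht, ht'⟩, rfl⟩
  refine ⟨x ^ (m - n) • t, ⟨hN (N.smul_mem _ ht), ?_⟩, ?_⟩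
  · change x ^ (n + 1) • x ^ (m - n) • t = 0
    rw [smul_smul, ← pow_add, show n + 1 + (m - n) = m + 1 by omega]
    exact ht'
  · change x ^ n • x ^ (m - n) • t = x ^ m • t
    rw [smul_smul, ← pow_add, show n + (m - n) = m by omega]

lemma eq_of_powSocle_eq {x : S} (hx : ∀ t : T, ∃ n : ℕ, x ^ n • t = 0) {N' N : Submodule S T}
    (hN : N' ≤ N) (h : ∀ n, powSocle x n N = powSocle x n N') : N = N' := by
  refine le_antisymm (fun t ht ↦ ?_) hN
  obtain ⟨n, hn⟩ := hx t
  induction n generalizing t with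
  | zero => rw [pow_zero, one_smul] at hn; exact hn ▸ N'.zero_mem
  | succ n ih =>
    obtain ⟨t', ⟨ht', -⟩, h'⟩ : x ^ n • t ∈ powSocle x n N' := h n ▸ ⟨t, ⟨ht, hn⟩, rfl⟩
    have h' : x ^ n • t' = x ^ n • t := h'
    have := ih (t - t') (N.sub_mem ht (hN ht')) (by rw [smul_sub, h', sub_self])
    simpa using N'.add_mem this ht'

lemma isArtinian_of_ker_smulMap {x : S} (hx : ∀ t : T, ∃ n : ℕ, x ^ n • t = 0)
    (h : IsArtinian S (LinearMap.ker (smulMap T x))) : IsArtinian S T := by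
  rw [← monotone_stabilizes_iff_artinian]
  intro f
  let F (i n : ℕ) : Submodule S (LinearMap.ker (smulMap T x)) :=
    (powSocle x n (OrderDual.ofDual (f i))).comap (Submodule.subtype _)
  have hF {i n j m : ℕ} (hij : i ≤ j) (hnm : n ≤ m) : F j m ≤ F i n :=
    Submodule.comap_mono (powSocle_mono x hnm (f.monotone hij))
  obtain ⟨k, hk⟩ := monotone_stabilizes_iff_artinian.2 h
    ⟨fun k ↦ OrderDual.toDual (F k k), fun a b hab ↦ hF hab hab⟩
  have hstep (n : ℕ) : ∃ i, ∀ j, i ≤ j → F i n = F j n :=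
    monotone_stabilizes_iff_artinian.2 h
      ⟨fun k ↦ OrderDual.toDual (F k n), fun a b hab ↦ hF hab le_rfl⟩
  choose i hi using hstep
  have hdiag {a n : ℕ} (ha : k ≤ a) (hn : k ≤ n) : F a n = F k k := by
    refine le_antisymm (hF ha hn) ?_
    rw [show F k k = F (max a n) (max a n) from hk (max a n) (by omega)]
    exact hF (le_max_left _ _) (le_max_right _ _)
  let i₀ := max k ((Finset.range k).sup i)
  refine ⟨i₀, fun j hj ↦ eq_of_powSocle_eq hx (f.monotone hj) fun n ↦ ?_⟩
  have hfin : F i₀ n = F j n := by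
    by_cases hn : n < k
    · have h1 : i n ≤ i₀ := (Finset.le_sup (f := i) (Finset.mem_range.2 hn)).trans (le_max_right _ _)
      rw [← hi n i₀ h1, hi n j (h1.trans hj)]
    · rw [hdiag (le_max_left _ _) (by omega), hdiag ((le_max_left _ _).trans hj) (by omega)]
  have := congr_arg (Submodule.map (Submodule.subtype _)) hfin
  simp only [F, Submodule.map_comap_subtype, inf_eq_right.2 (powSocle_le_ker _ _ _)] at this
  exact this

lemma isArtinian_of_torsionBySet_finset (s : Finset S) :
    ∀ (T : Type u) [AddCommGroup T] [Module S T], (∀ x ∈ s, ∀ t : T, ∃ n : ℕ, x ^ n • t = 0) →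
      IsArtinian S (Submodule.torsionBySet S T (s : Set S)) → IsArtinian S T := by
  classical
  induction s using Finset.induction_on with
  | empty =>
    intro T _ _ _ h
    refine isArtinian_of_injective (LinearMap.id.codRestrict
      (Submodule.torsionBySet S T ((∅ : Finset S) : Set S)) fun t ↦ ?_)
      fun s t h ↦ congr_arg Subtype.val h
    simp [Submodule.mem_torsionBySet_iff]
  | insert x s _ ih =>
    intro T _ _ hT h
    refine isArtinian_of_ker_smulMap (hT x (by simp)) (ih _ (fun y hy t ↦ ?_) ?_)
    · obtain ⟨n, hn⟩ := hT y (by simp [hy]) t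
      exact ⟨n, Subtype.ext hn⟩
    · refine isArtinian_of_injective ((Submodule.subtype _ ∘ₗ Submodule.subtype _).codRestrict
        (Submodule.torsionBySet S T ((insert x s : Finset S) : Set S)) fun t ↦ ?_) fun s t h ↦ by
        have h' := congr_arg Subtype.val h
        exact Subtype.ext (Subtype.ext h')
      rw [Submodule.mem_torsionBySet_iff]
      rintro ⟨y, hy⟩
      rw [Finset.coe_insert] at hy
      rcases hy with rfl | hy
      · exact t.1.2
      · exact congr_arg Subtype.val ((Submodule.mem_torsionBySet_iff _ _).1 t.2 ⟨y, hy⟩)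

lemma IsPowTorsion.isArtinian [IsNoetherianRing S] (hT : IsPowTorsion J T)
    (h : IsArtinian S (Submodule.torsionBySet S T J)) : IsArtinian S T := by
  obtain ⟨s, rfl⟩ := IsNoetherian.noetherian J
  rw [← Submodule.torsionBySet_eq_torsionBySet_span] at h
  refine isArtinian_of_torsionBySet_finset s T (fun x hx t ↦ ?_) h
  obtain ⟨n, hn⟩ := hT t
  exact ⟨n, hn _ (Ideal.pow_mem_pow (Ideal.subset_span hx) n)⟩

/-- A submodule on which every element acts surjectively or nilpotently. -/
def IsSecondary (N : Submodule S T) : Prop :=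
  ∀ a : S, N.map (smulMap T a) = N ∨ a ∈ N.annihilator.radical

lemma map_smulMap_le (a : S) (N : Submodule S T) : N.map (smulMap T a) ≤ N := by
  rintro _ ⟨t, ht, rfl⟩
  exact N.smul_mem a ht

lemma map_smulMap_pow_succ (a : S) (n : ℕ) (N : Submodule S T) :
    N.map (smulMap T (a ^ (n + 1))) = (N.map (smulMap T (a ^ n))).map (smulMap T a) := by
  rw [← Submodule.map_comp]
  congr 1
  ext t
  simp [pow_succ', mul_smul, smul_comm a]

lemma map_smulMap_pow {a : S} {N : Submodule S T} (h : N.map (smulMap T a) = N) (n : ℕ) :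
    N.map (smulMap T (a ^ n)) = N := by
  induction n with
  | zero =>
    rw [show smulMap T (a ^ 0) = LinearMap.id by ext; simp, Submodule.map_id]
  | succ n ih => rw [map_smulMap_pow_succ, ih, h]

lemma exists_finset_isSecondary [IsArtinian S T] (N : Submodule S T) :
    ∃ s : Finset (Submodule S T), (∀ N ∈ s, IsSecondary N) ∧ N ≤ s.sup id := by
  classical
  induction N using WellFoundedLT.induction with
  | ind N ih =>
  by_cases hN : IsSecondary N
  · exact ⟨{N}, by simpa, by simp⟩
  simp only [IsSecondary, not_forall, not_or] at hN
  obtain ⟨a, ha, ha'⟩ := hN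
  have hanti {n m : ℕ} (hnm : n ≤ m) :
      N.map (smulMap T (a ^ m)) ≤ N.map (smulMap T (a ^ n)) := by
    induction m, hnm using Nat.le_induction with
    | base => rfl
    | succ m _ h => exact (map_smulMap_pow_succ a m N).trans_le ((map_smulMap_le _ _).trans h)
  obtain ⟨n, hn⟩ := monotone_stabilizes_iff_artinian.2 (inferInstance : IsArtinian S T)
    ⟨fun k ↦ OrderDual.toDual (N.map (smulMap T (a ^ k))), fun i j hij ↦ hanti hij⟩
  have hn : ∀ m, n ≤ m → N.map (smulMap T (a ^ n)) = N.map (smulMap T (a ^ m)) := hn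
  have h1 : N.map (smulMap T (a ^ (n + 1))) < N := by
    refine lt_of_le_of_ne (map_smulMap_le _ _) fun h ↦ ha (le_antisymm (map_smulMap_le _ _) ?_)
    calc N = N.map (smulMap T (a ^ (n + 1))) := h.symm
      _ ≤ N.map (smulMap T (a ^ 1)) := hanti (by omega)
      _ = _ := by rw [pow_one]
  have h2 : N ⊓ LinearMap.ker (smulMap T (a ^ (n + 1))) < N := by
    refine lt_of_le_of_ne inf_le_left fun h ↦ ha' ⟨n + 1, ?_⟩
    rw [Submodule.mem_annihilator]
    intro t ht
    exact (inf_eq_left.1 h) ht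
  obtain ⟨s₁, hs₁, hs₁'⟩ := ih _ h1
  obtain ⟨s₂, hs₂, hs₂'⟩ := ih _ h2
  refine ⟨s₁ ∪ s₂, fun P hP ↦ (Finset.mem_union.1 hP).elim (hs₁ P) (hs₂ P), ?_⟩
  rw [Finset.sup_union]
  refine le_trans (fun t ht ↦ ?_) (sup_le_sup hs₁' hs₂')
  have h3 : a ^ (n + 1) • t ∈ N.map (smulMap T (a ^ (n + 1 + (n + 1)))) := by
    rw [← hn _ (by omega), hn (n + 1) (by omega)]
    exact ⟨t, ht, rfl⟩
  obtain ⟨t', ht', h4⟩ := h3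
  have h4 : a ^ (n + 1 + (n + 1)) • t' = a ^ (n + 1) • t := h4
  refine Submodule.mem_sup.2 ⟨a ^ (n + 1) • t', ⟨t', ht', rfl⟩, t - a ^ (n + 1) • t',
    ⟨N.sub_mem ht (N.smul_mem _ ht'), ?_⟩, by abel⟩
  change a ^ (n + 1) • (t - a ^ (n + 1) • t') = 0
  rw [smul_sub, smul_smul, ← pow_add, h4, sub_self]

lemma IsSecondary.isPrime {N : Submodule S T} (hN : IsSecondary N) (h0 : N ≠ ⊥) :
    N.annihilator.radical.IsPrime := by
  refine ⟨fun h ↦ h0 ?_, fun {a b} hab ↦ or_iff_not_imp_left.2 fun ha ↦ ?_⟩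
  · rwa [Ideal.radical_eq_top, Submodule.annihilator_eq_top_iff] at h
  · obtain ⟨k, hk⟩ := hab
    refine ⟨k, Submodule.mem_annihilator.2 fun t ht ↦ ?_⟩
    rw [← map_smulMap_pow ((hN a).resolve_right ha) k] at ht
    obtain ⟨t, ht, rfl⟩ := ht
    change b ^ k • a ^ k • t = 0
    rw [smul_smul, ← mul_pow, mul_comm]
    exact Submodule.mem_annihilator.1 hk t ht

/-- In an Artinian module, some `y ∈ J` is surjective up to the elements killed by a power
of `J`. -/
lemma exists_range_smulMap_sup_torsionBySet_eq_top [IsNoetherianRing S] [IsArtinian S T]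
    (J : Ideal S) : ∃ y ∈ J, ∃ m : ℕ,
      LinearMap.range (smulMap T y) ⊔ Submodule.torsionBySet S T (J ^ m : Ideal S) = ⊤ := by
  classical
  obtain ⟨s, hs, hs'⟩ := exists_finset_isSecondary (⊤ : Submodule S T)
  let s' := s.filter fun N ↦ N ≠ ⊥ ∧ ¬ J ≤ N.annihilator.radical
  have h1 : ¬ ((J : Set S) ⊆ ⋃ N ∈ (s' : Set (Submodule S T)), N.annihilator.radical) := by
    rw [Ideal.subset_union_prime (s := s') (f := fun N ↦ N.annihilator.radical) ⊥ ⊥]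
    · rintro ⟨N, hN, h⟩
      exact (Finset.mem_filter.1 hN).2.2 h
    · intro N hN _ _
      exact (hs N (Finset.mem_filter.1 hN).1).isPrime (Finset.mem_filter.1 hN).2.1
  obtain ⟨y, hy, hy'⟩ := Set.not_subset.1 h1
  have h2 : ∀ N : Submodule S T, J ≤ N.annihilator.radical → ∃ m : ℕ, J ^ m ≤ N.annihilator :=
    fun N h ↦ Ideal.exists_pow_le_of_le_radical_of_fg h (IsNoetherian.noetherian J)
  choose! m hm using h2
  refine ⟨y, hy, s.sup m, top_le_iff.1 (hs'.trans (Finset.sup_le fun N hN ↦ ?_))⟩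
  by_cases hN' : N ∈ s'
  · refine le_trans ?_ le_sup_left
    have : y ∉ N.annihilator.radical := fun h ↦ hy' (Set.mem_biUnion hN' h)
    rw [id, ← ((hs N hN) y).resolve_right this]
    exact LinearMap.map_le_range
  · by_cases h0 : N = ⊥
    · simp [h0]
    refine le_trans ?_ le_sup_right
    have h3 : J ≤ N.annihilator.radical := by
      by_contra h
      exact hN' (Finset.mem_filter.2 ⟨hN, h0, h⟩)
    intro t ht
    rw [Submodule.mem_torsionBySet_iff]
    rintro ⟨a, ha⟩
    exact Submodule.mem_annihilator.1 (hm N h3 (Ideal.pow_le_pow_right (Finset.le_sup hN) ha)) t ht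

end

section

variable {S : Type u} [CommRing S] {J : Ideal S}
  {T : Type u} [AddCommGroup T] [Module S T]

lemma isArtinian_of_le_radical_annihilator [IsNoetherianRing S]
    (hJ : ∀ p : Ideal S, p.IsPrime → J ≤ p → p.IsMaximal)
    [hfin : Module.Finite S T] (hT : J ≤ (Module.annihilator S T).radical) : IsArtinian S T := by
  induction hfin using IsNoetherianRing.induction_on_isQuotientEquivQuotientPrime with
  | subsingleton N => infer_instance
  | quotient N p e =>
    rw [e.annihilator_eq, Ideal.annihilator_quotient, p.2.radical] at hT
    have := hJ _ p.2 hT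
    have : IsSimpleModule S (S ⧸ p.asIdeal) := isSimpleModule_iff_isCoatom.2 this.out
    exact isArtinian_of_injective e.toLinearMap e.injective
  | exact N₁ N₂ N₃ f g hf hg hfg h₁ h₃ =>
    have := h₁ (hT.trans (Ideal.radical_mono (f.annihilator_le_of_injective hf)))
    have := h₃ (hT.trans (Ideal.radical_mono (g.annihilator_le_of_surjective hg)))
    exact isArtinian_of_range_eq_ker f g hfg.linearMap_ker_eq.symm

lemma isPowTorsion_ker (f : T →ₗ[S] T) (hT : IsPowTorsion J T) :
    IsPowTorsion J (LinearMap.ker f) := hT.of_injective _ (Submodule.subtype_injective _)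

/-- The inclusion of the `J`-torsion of a submodule. -/
def torsionBySetMap (J : Ideal S) (N : Submodule S T) :
    Submodule.torsionBySet S N J →ₗ[S] Submodule.torsionBySet S T J :=
  (Submodule.subtype _ ∘ₗ Submodule.subtype _).codRestrict _ fun t ↦ by
    rw [Submodule.mem_torsionBySet_iff]
    exact fun a ↦ congr_arg Subtype.val ((Submodule.mem_torsionBySet_iff _ _).1 t.2 a)

lemma torsionBySetMap_injective (J : Ideal S) (N : Submodule S T) :
    Function.Injective (torsionBySetMap J N) := fun s t h ↦ by
  have h' := congr_arg Subtype.val h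
  exact Subtype.ext (Subtype.ext h')

lemma annihilator_lt_annihilator_ker {y : S} (hy : y ∉ Module.annihilator S T) :
    Module.annihilator S T < Module.annihilator S (LinearMap.ker (smulMap T y)) := by
  refine lt_of_le_of_ne
    (LinearMap.annihilator_le_of_injective _ (Submodule.subtype_injective _)) fun h ↦ hy ?_
  rw [h, Module.mem_annihilator]
  exact fun t ↦ Subtype.ext t.2

lemma IsPowTorsion.extFinite_of_isArtinian [IsNoetherianRing S] (hT : IsPowTorsion J T)
    (hA : IsArtinian S (Submodule.torsionBySet S T J))
    (hN : IsNoetherian S (Submodule.torsionBySet S T J)) : ExtFinite J T := by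
  induction h : Module.annihilator S T using WellFoundedGT.induction generalizing T with
  | ind a ih =>
  subst h
  have := hT.isArtinian hA
  obtain ⟨y, hy, m, h⟩ := exists_range_smulMap_sup_torsionBySet_eq_top (T := T) J
  have hN' := isNoetherian_torsionBySet_pow (isNoetherian_ext_zero hN) m
  by_cases hy' : y ∈ Module.annihilator S T
  · rw [LinearMap.range_eq_bot.2 (LinearMap.ext fun t ↦ Module.mem_annihilator.1 hy' t),
      bot_sup_eq] at h
    rw [h] at hN'
    exact extFinite_of_isNoetherian J (isNoetherian_of_linearEquiv Submodule.topEquiv)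
  · refine .of_smulMap hy (ih _ (annihilator_lt_annihilator_ker hy') (isPowTorsion_ker _ hT)
      (isArtinian_of_injective _ (torsionBySetMap_injective J _))
      (isNoetherian_of_injective _ (torsionBySetMap_injective J _)) rfl)
      (extFinite_of_isNoetherian _ ?_)
    refine isNoetherian_of_surjective
      ((LinearMap.range (smulMap T y)).mkQ ∘ₗ (Submodule.torsionBySet S T (J ^ m : Ideal S)).subtype) ?_
    rw [LinearMap.range_comp,
      Submodule.range_subtype, Submodule.map_mkQ_eq_top, h]

/-- The elements avoiding all minimal primes of `J`. -/
def minimalPrimesCompl (J : Ideal S) : Submonoid S where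
  carrier := {u | ∀ p ∈ J.minimalPrimes, u ∉ p}
  one_mem' p hp h := hp.1.1.ne_top ((Ideal.eq_top_iff_one p).2 h)
  mul_mem' ha hb p hp h := (hp.1.1.mem_or_mem h).elim (ha p hp) (hb p hp)

lemma exists_smul_eq_zero_of_forall (U : Submonoid S) [Module.Finite S T]
    (h : ∀ t : T, ∃ u ∈ U, u • t = 0) : ∃ u ∈ U, ∀ t : T, u • t = 0 := by
  classical
  obtain ⟨s, hs⟩ := Module.Finite.fg_top (R := S) (M := T)
  choose v hv hv' using h
  refine ⟨∏ t ∈ s, v t, U.prod_mem fun t _ ↦ hv t, fun t ↦ ?_⟩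
  have : t ∈ Submodule.span S (s : Set T) := hs ▸ trivial
  induction this using Submodule.span_induction with
  | mem x hx =>
    rw [← Finset.prod_erase_mul s v hx, mul_smul, hv', smul_zero]
  | zero => simp
  | add x y _ _ hx hy => rw [smul_add, hx, hy, add_zero]
  | smul b x _ hx => rw [smul_comm, hx, smul_zero]

lemma extFinite_of_finite_generically [IsNoetherianRing S]
    (hJ : ∀ p q : Ideal S, p.IsPrime → q.IsPrime → J ≤ p → p < q → q.IsMaximal)
    (hT : IsPowTorsion J T) (h0 : IsNoetherian S (ModuleExt S (S ⧸ J) T 0))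
    (F : Submodule S T) (hF : IsNoetherian S F)
    (h : ∀ t : T, ∃ u ∈ minimalPrimesCompl J, u • t ∈ F) : ExtFinite J T := by
  have hF' := extFinite_of_isNoetherian J hF
  have h1 := ModuleExt.noeth_post_right (Submodule.subtype_injective _)
    (LinearMap.exact_subtype_mkQ F) (Submodule.mkQ_surjective _) h0 (hF' 1)
  have h2 := isNoetherian_torsionBySet h1
  have hfin : Module.Finite S (Submodule.torsionBySet S (T ⧸ F) J) := inferInstance
  obtain ⟨u, hu, hu'⟩ := exists_smul_eq_zero_of_forall (minimalPrimesCompl J)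
    (T := Submodule.torsionBySet S (T ⧸ F) J) fun t ↦ by
      obtain ⟨t, ht⟩ := t
      obtain ⟨t, rfl⟩ := Submodule.mkQ_surjective _ t
      obtain ⟨u, hu, h⟩ := h t
      refine ⟨u, hu, Subtype.ext ?_⟩
      change u • Submodule.mkQ F t = 0
      rw [← map_smul]
      exact (Submodule.Quotient.mk_eq_zero _).2 h
  have h3 : IsArtinian S (Submodule.torsionBySet S (T ⧸ F) J) := by
    refine isArtinian_of_le_radical_annihilator (J := J ⊔ Ideal.span {u}) (fun q hq hle ↦ ?_)
      (le_trans (sup_le (fun a ha ↦ ?_) ?_) Ideal.le_radical)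
    · have := hq
      obtain ⟨p, hp, hpq⟩ := Ideal.exists_minimalPrimes_le (le_sup_left.trans hle)
      refine hJ p q hp.1.1 hq hp.1.2 (lt_of_le_of_ne hpq fun h ↦ hu p hp (h ▸ hle ?_))
      exact Ideal.mem_sup_right (Ideal.mem_span_singleton_self u)
    · rw [Module.mem_annihilator]
      exact fun t ↦ Subtype.ext ((Submodule.mem_torsionBySet_iff _ _).1 t.2 ⟨a, ha⟩)
    · rwa [Ideal.span_singleton_le_iff_mem, Module.mem_annihilator]
  have h4 := (hT.of_surjective _ F.mkQ_surjective).extFinite_of_isArtinian h3 h2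
  exact fun j ↦ ModuleExt.noeth_post_mid (Submodule.subtype_injective _)
    (LinearMap.exact_subtype_mkQ F) (Submodule.mkQ_surjective _) (hF' j) (h4 j)

lemma IsPowTorsion.localizedModule (U : Submonoid S) (hT : IsPowTorsion J T) :
    IsPowTorsion (J.map (algebraMap S (Localization U))) (LocalizedModule U T) := by
  intro t
  obtain ⟨⟨t, u⟩, rfl⟩ := IsLocalizedModule.mk'_surjective U (LocalizedModule.mkLinearMap U T) t
  obtain ⟨n, hn⟩ := hT t
  refine ⟨n, fun a ha ↦ ?_⟩
  rw [← Ideal.map_pow, Ideal.map] at ha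
  induction ha using Submodule.span_induction with
  | mem a ha =>
    obtain ⟨a, ha, rfl⟩ := ha
    rw [algebraMap_smul, Function.uncurry_apply_pair, ← IsLocalizedModule.mk'_smul, hn a ha,
      IsLocalizedModule.mk'_zero]
  | zero => simp
  | add x y _ _ hx hy => rw [add_smul, hx, hy, add_zero]
  | smul b x _ hx => rw [smul_assoc, hx, smul_zero]

lemma exists_mk_eq_of_mem_torsionBySet (U : Submonoid S) {I : Ideal S} (hI : I.FG)
    {t : LocalizedModule U T} (ht : ∀ a ∈ I, a • t = 0) :
    ∃ s ∈ Submodule.torsionBySet S T I, ∃ u ∈ U, u • t = LocalizedModule.mkLinearMap U T s := by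
  classical
  obtain ⟨⟨t, u⟩, rfl⟩ := IsLocalizedModule.mk'_surjective U (LocalizedModule.mkLinearMap U T) t
  obtain ⟨s, rfl⟩ := hI
  have h1 : ∀ a ∈ Ideal.span (s : Set S), ∃ v ∈ U, v • a • t = 0 := by
    intro a ha
    have := ht a ha
    rw [Function.uncurry_apply_pair, ← IsLocalizedModule.mk'_smul,
      IsLocalizedModule.mk'_eq_zero'] at this
    obtain ⟨v, hv⟩ := this
    exact ⟨v, v.2, hv⟩
  choose! v hv hv' using h1
  refine ⟨(∏ a ∈ s, v a) • t, ?_, (∏ a ∈ s, v a) * u, U.mul_mem (U.prod_mem fun a ha ↦ hv a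
    (Ideal.subset_span ha)) u.2, ?_⟩
  · rw [← Submodule.torsionBySet_eq_torsionBySet_span, Submodule.mem_torsionBySet_iff]
    rintro ⟨a, ha⟩
    change a • (∏ a ∈ s, v a) • t = 0
    rw [smul_comm, ← Finset.prod_erase_mul s v ha, mul_smul, hv' a (Ideal.subset_span ha),
      smul_zero]
  · rw [mul_smul, Function.uncurry_apply_pair, map_smul]
    congr 1
    exact IsLocalizedModule.mk'_cancel' (LocalizedModule.mkLinearMap U T) t u

lemma exists_generic_range_smulMap_sup [IsNoetherianRing S]
    (hT : IsPowTorsion J T) (hN : IsNoetherian S (Submodule.torsionBySet S T J)) :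
    ∃ y ∈ J, ∃ m : ℕ, ∀ t : T, ∃ u ∈ minimalPrimesCompl J, u • t ∈
      LinearMap.range (smulMap T y) ⊔ Submodule.torsionBySet S T (J ^ m : Ideal S) := by
  set U := minimalPrimesCompl J
  let S' := Localization U
  let φ := LocalizedModule.mkLinearMap U T
  let J' := J.map (algebraMap S S')
  have : IsNoetherianRing S' := IsLocalization.isNoetherianRing U S' inferInstance
  have hmax : ∀ P : Ideal S', P.IsPrime → J' ≤ P → P.comap (algebraMap S S') ∈ J.minimalPrimes := by
    intro P hP hle
    have hle' : J ≤ P.comap (algebraMap S S') := Ideal.map_le_iff_le_comap.1 hle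
    have hp : (P.comap (algebraMap S S')).IsPrime := hP.comap _
    have hdis := (IsLocalization.isPrime_iff_isPrime_disjoint U S' P).1 hP
    have hfin := J.finite_minimalPrimes_of_isNoetherianRing
    have hsub : ((P.comap (algebraMap S S') : Ideal S) : Set S) ⊆ ⋃ p ∈ (hfin.toFinset : Set (Ideal S)), p := by
      intro a ha
      by_contra h
      refine Set.disjoint_left.1 hdis.2 (show a ∈ (U : Set S) from fun p hp' hap ↦ h ?_) ha
      exact Set.mem_biUnion (hfin.mem_toFinset.2 hp') hap
    obtain ⟨p, hp', hpP⟩ := (Ideal.subset_union_prime (s := hfin.toFinset) (f := fun p ↦ p) ⊥ ⊥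
      fun p hp' _ _ ↦ (hfin.mem_toFinset.1 hp').1.1).1 hsub
    have hp'' : p ∈ J.minimalPrimes := hfin.mem_toFinset.1 hp'
    have : P.comap (algebraMap S S') = p := le_antisymm hpP (hp''.2 ⟨hp, hle'⟩ hpP)
    rwa [this]
  have hmax' : ∀ P : Ideal S', P.IsPrime → J' ≤ P → P.IsMaximal := by
    intro P hP hle
    obtain ⟨Q, hQ, hPQ⟩ := P.exists_le_maximal hP.ne_top
    have h1 := hmax P hP hle
    have h2 := hmax Q hQ.isPrime (hle.trans hPQ)
    have h3 : P.comap (algebraMap S S') = Q.comap (algebraMap S S') :=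
      le_antisymm (Ideal.comap_mono hPQ) (h2.2 h1.1 (Ideal.comap_mono hPQ))
    have h4 : P = Q := by
      rw [← IsLocalization.map_under U S' P, ← IsLocalization.map_under U S' Q]
      exact congr_arg _ h3
    rwa [h4]
  have hN' : IsNoetherian S' (Submodule.torsionBySet S' (LocalizedModule U T) J') := by
    obtain ⟨s, hs⟩ := (Module.Finite.iff_fg (N := Submodule.torsionBySet S T J)).1 inferInstance
    let N₀ := Submodule.span S' (φ '' (s : Set T))
    have : Module.Finite S' N₀ := Module.Finite.iff_fg.2
      (Submodule.fg_span (s.finite_toSet.image φ))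
    refine isNoetherian_of_le (t := N₀) fun x hx ↦ ?_
    obtain ⟨s₁, hs₁, u, hu, hsu⟩ := exists_mk_eq_of_mem_torsionBySet U
      (IsNoetherian.noetherian J) (t := x) fun a ha ↦
        (algebraMap_smul S' a x).symm.trans
          ((Submodule.mem_torsionBySet_iff _ _).1 hx ⟨_, Ideal.mem_map_of_mem _ ha⟩)
    have h1 : s₁ ∈ (N₀.restrictScalars S).comap φ := by
      refine (Submodule.span_le (s := (s : Set T))).2 (fun t ht ↦ ?_) (hs ▸ hs₁)
      exact Submodule.subset_span ⟨t, ht, rfl⟩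
    rw [← (Submodule.smul_mem_iff_of_isUnit N₀ (IsLocalization.map_units S' ⟨u, hu⟩)),
      algebraMap_smul]
    exact hsu ▸ h1
  have hA' : IsArtinian S' (Submodule.torsionBySet S' (LocalizedModule U T) J') := by
    refine isArtinian_of_le_radical_annihilator hmax' (le_trans (fun a ha ↦ ?_) Ideal.le_radical)
    rw [Module.mem_annihilator]
    exact fun t ↦ Subtype.ext ((Submodule.mem_torsionBySet_iff _ _).1 t.2 ⟨a, ha⟩)
  have := (hT.localizedModule U).isArtinian hA'
  obtain ⟨y', hy', m, h⟩ := exists_range_smulMap_sup_torsionBySet_eq_top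
    (T := LocalizedModule U T) J'
  obtain ⟨⟨⟨y, hy⟩, w⟩, hyw⟩ := (IsLocalization.mem_map_algebraMap_iff U S').1 hy'
  refine ⟨y, hy, m, fun t ↦ ?_⟩
  obtain ⟨_, ⟨t₁, rfl⟩, s, hs, hst⟩ := Submodule.mem_sup.1 (h ▸ Submodule.mem_top (x := φ t))
  obtain ⟨s₁, hs₁, u, hu, hsu⟩ := exists_mk_eq_of_mem_torsionBySet U
    (IsNoetherian.noetherian (J ^ m)) (t := s) fun a ha ↦ by
      have := (Submodule.mem_torsionBySet_iff _ _).1 hs ⟨algebraMap S S' a, by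
        rw [← Ideal.map_pow]; exact Ideal.mem_map_of_mem _ ha⟩
      exact (algebraMap_smul S' a s).symm.trans this
  obtain ⟨⟨t₁, v⟩, rfl⟩ := IsLocalizedModule.mk'_surjective U φ t₁
  have h1 : φ ((u * w * v) • t) = φ ((u : S) • y • t₁ + (w * v : S) • s₁) := by
    rw [map_smul, ← hst, smul_add, map_add, map_smul _ (w * v : S), ← hsu]
    congr 1
    · have h2 : (v : S) • IsLocalizedModule.mk' φ t₁ v = φ t₁ := IsLocalizedModule.mk'_cancel' φ t₁ v
      change (u * w * v : S) • y' • IsLocalizedModule.mk' φ t₁ v = _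
      have h3 : (w : S) • y' • φ t₁ = y • φ t₁ := by
        rw [← algebraMap_smul S' (w : S), smul_smul, mul_comm, hyw, algebraMap_smul]
      rw [mul_smul, mul_smul, smul_comm (v : S) y', h2, h3, map_smul, map_smul]
    · simp only [smul_smul]; congr 1; ring
  obtain ⟨c, hc⟩ := (IsLocalizedModule.eq_iff_exists U φ).1 h1
  refine ⟨c * (u * w * v), U.mul_mem c.2 (U.mul_mem (U.mul_mem hu w.2) v.2), ?_⟩
  rw [mul_smul, show (c : S) • (u * w * v : S) • t = _ from hc, Submonoid.smul_def, smul_add]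
  refine Submodule.add_mem_sup ⟨(c : S) • (u : S) • t₁, ?_⟩ (Submodule.smul_mem _ _ (Submodule.smul_mem _ _ hs₁))
  change y • (c : S) • (u : S) • t₁ = _
  rw [smul_comm y, smul_comm y]

lemma extFiniteOfLow_of_dim_le_one [IsNoetherianRing S]
    (hJ : ∀ p q : Ideal S, p.IsPrime → q.IsPrime → J ≤ p → p < q → q.IsMaximal) :
    ExtFiniteOfLow J := by
  intro T _ _ hT h0 h1
  induction h : Module.annihilator S T using WellFoundedGT.induction generalizing T with
  | ind a ih =>
  subst h
  obtain ⟨y, hy, m, h⟩ := exists_generic_range_smulMap_sup hT (isNoetherian_torsionBySet h0)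
  have hN := isNoetherian_torsionBySet_pow h0 m
  by_cases hy' : y ∈ Module.annihilator S T
  · rw [LinearMap.range_eq_bot.2 (LinearMap.ext fun t ↦ Module.mem_annihilator.1 hy' t),
      bot_sup_eq] at h
    exact extFinite_of_finite_generically hJ hT h0 _ hN h
  · have hK := ih _ (annihilator_lt_annihilator_ker hy') _ (isPowTorsion_ker _ hT)
      (isNoetherian_ext_ker _ h0) (isNoetherian_ext_ker_one _ h0 h1) rfl
    refine .of_smulMap hy hK ?_
    refine extFinite_of_finite_generically hJ (hT.of_surjective _ (Submodule.mkQ_surjective _))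
      (isNoetherian_ext_coker _ 0 h0 h1 (hK 2))
      ((Submodule.torsionBySet S T (J ^ m : Ideal S)).map (Submodule.mkQ _)) ?_ fun t ↦ ?_
    · infer_instance
    · obtain ⟨t, rfl⟩ := Submodule.mkQ_surjective _ t
      obtain ⟨u, hu, hut⟩ := h t
      refine ⟨u, hu, ?_⟩
      rw [← map_smul, ← Submodule.mem_comap, Submodule.comap_map_mkQ]
      exact hut

end

section DimensionFour

variable {R : Type u} [CommRing R]

lemma not_chain_of_ringKrullDim_le_four (hdim : ringKrullDim R ≤ 4) {p₀ p₁ p₂ p₃ p₄ p₅ : Ideal R}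
    (h₀ : p₀.IsPrime) (h₁ : p₁.IsPrime) (h₂ : p₂.IsPrime) (h₃ : p₃.IsPrime) (h₄ : p₄.IsPrime)
    (h₅ : p₅.IsPrime) (h₀₁ : p₀ < p₁) (h₁₂ : p₁ < p₂) (h₂₃ : p₂ < p₃) (h₃₄ : p₃ < p₄)
    (h₄₅ : p₄ < p₅) : False := by
  let c : LTSeries (PrimeSpectrum R) := LTSeries.mk 5
    ![⟨p₀, h₀⟩, ⟨p₁, h₁⟩, ⟨p₂, h₂⟩, ⟨p₃, h₃⟩, ⟨p₄, h₄⟩, ⟨p₅, h₅⟩] (by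
      rw [Fin.strictMono_iff_lt_succ]
      intro i
      fin_cases i
      exacts [h₀₁, h₁₂, h₂₃, h₃₄, h₄₅])
  have hc : ((5 : ℕ) : WithBot ℕ∞) ≤ ringKrullDim R := Order.LTSeries.length_le_krullDim c
  have := hc.trans hdim
  exact absurd this (by decide)

lemma ringKrullDim_quotient_le_one {D : Ideal R} (h : ∀ p q r : Ideal R, p.IsPrime → q.IsPrime →
    r.IsPrime → D ≤ p → p < q → q < r → False) : ringKrullDim (R ⧸ D) ≤ 1 := by
  rw [ringKrullDim_quotient]
  refine iSup_le fun c ↦ ?_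
  by_contra hc
  have hl : 2 ≤ c.length := by
    by_contra hl
    refine hc ?_
    have : c.length ≤ 1 := by omega
    exact_mod_cast this
  refine h (c ⟨0, by omega⟩).1.1 (c ⟨1, by omega⟩).1.1 (c ⟨2, by omega⟩).1.1 (c _).1.2 (c _).1.2
    (c _).1.2 (c _).2 ?_ ?_
  · exact c.strictMono (show (⟨0, by omega⟩ : Fin (c.length + 1)) < ⟨1, by omega⟩ from Fin.mk_lt_mk.2 zero_lt_one)
  · exact c.strictMono (show (⟨1, by omega⟩ : Fin (c.length + 1)) < ⟨2, by omega⟩ from Fin.mk_lt_mk.2 one_lt_two)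

lemma exists_eq_span_singleton_of_forall_not_lt [IsDomain R] [UniqueFactorizationMonoid R]
    {P : Ideal R} [hP : P.IsPrime] (h : ∀ q : Ideal R, q.IsPrime → q ≠ ⊥ → ¬ q < P) :
    ∃ f, P = Ideal.span {f} := by
  by_cases hb : P = ⊥
  · exact ⟨0, by simpa using hb⟩
  · obtain ⟨p, hpP, hp⟩ := hP.exists_mem_prime_of_ne_bot hb
    have hpr : (Ideal.span {p}).IsPrime := (Ideal.span_singleton_prime hp.ne_zero).2 hp
    have hle : Ideal.span {p} ≤ P := (Ideal.span_singleton_le_iff_mem _).2 hpP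
    refine ⟨p, (hle.eq_of_not_lt (h _ hpr ?_)).symm⟩
    simpa using hp.ne_zero

lemma exists_splitting [IsNoetherianRing R] [IsDomain R] [UniqueFactorizationMonoid R]
    (I : Ideal R) : ∃ (f : R) (J : Ideal R),
      (∀ p : Ideal R, p.IsPrime → f ∈ p → ∃ q ∈ I.minimalPrimes, q ≤ p ∧
        ∀ r : Ideal R, r.IsPrime → r ≠ ⊥ → ¬ r < q) ∧
      (∀ p : Ideal R, p.IsPrime → J ≤ p → ∃ q ∈ I.minimalPrimes, q ≤ p ∧
        ∃ r : Ideal R, r.IsPrime ∧ r ≠ ⊥ ∧ r < q) ∧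
      (∀ p : Ideal R, p.IsPrime → I ≤ p → f ∈ p ∨ J ≤ p) := by
  classical
  have hfin := Ideal.finite_minimalPrimes_of_isNoetherianRing R I
  let low : Ideal R → Prop := fun q ↦ ∀ r : Ideal R, r.IsPrime → r ≠ ⊥ → ¬ r < q
  have hgen : ∀ q : Ideal R, ∃ g : R, q ∈ I.minimalPrimes → low q → q = Ideal.span {g} := by
    intro q
    by_cases hq : q ∈ I.minimalPrimes ∧ low q
    · have := hq.1.1.1
      obtain ⟨g, hg⟩ := exists_eq_span_singleton_of_forall_not_lt hq.2
      exact ⟨g, fun _ _ ↦ hg⟩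
    · exact ⟨0, fun h h' ↦ absurd ⟨h, h'⟩ hq⟩
  choose g hg using hgen
  refine ⟨∏ q ∈ hfin.toFinset.filter low, g q, ∏ q ∈ hfin.toFinset.filter (¬ low ·), q, ?_, ?_, ?_⟩
  · intro p hp hf
    obtain ⟨q, hq, hqp⟩ := hp.prod_mem_iff.1 hf
    simp only [Finset.mem_filter, Set.Finite.mem_toFinset] at hq
    refine ⟨q, hq.1, ?_, hq.2⟩
    rw [hg q hq.1 hq.2]
    exact (Ideal.span_singleton_le_iff_mem _).2 hqp
  · intro p hp hf
    obtain ⟨q, hq, hqp⟩ := hp.prod_le.1 hf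
    simp only [Finset.mem_filter, Set.Finite.mem_toFinset] at hq
    refine ⟨q, hq.1, hqp, ?_⟩
    have := hq.2
    simp only [low] at this
    push Not at this
    exact this
  · intro p hp hI
    obtain ⟨q, hq, hqp⟩ := Ideal.exists_minimalPrimes_le hI
    by_cases hl : low q
    · left
      refine hp.prod_mem_iff.2 ⟨q, by simp [hq, hl], hqp ?_⟩
      have := Ideal.mem_span_singleton_self (g q)
      rwa [← hg q hq hl] at this
    · right
      exact (Ideal.IsPrime.prod_le hp).2 ⟨q, by simp [hq, hl], hqp⟩

/-- For an ideal `I` of a four-dimensional Noetherian local unique factorization domain there is an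
ideal `D` of dimension at most one outside of which `I` is locally the product of a principal
ideal and an ideal of dimension at most one, up to radicals. -/
theorem exists_extFiniteOfLow [IsNoetherianRing R] [IsLocalRing R] [IsDomain R]
    [UniqueFactorizationMonoid R] (hdim : ringKrullDim R ≤ 4) (I : Ideal R) :
    ∃ D : Ideal R, ringKrullDim (R ⧸ D) ≤ 1 ∧
      ∀ x ∈ D, ExtFiniteOfLow (I.map (algebraMap R (Localization.Away x))) := by
  obtain ⟨f, J, hf, hJ, hI⟩ := exists_splitting I
  refine ⟨(Ideal.span {f} ⊔ J) ⊓ IsLocalRing.maximalIdeal R, ?_, fun x hx ↦ ?_⟩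
  · refine ringKrullDim_quotient_le_one fun p q r hp hq hr hDp hpq hqr ↦ ?_
    have hle : Ideal.span {f} ⊔ J ≤ p := (hp.inf_le.1 hDp).resolve_right fun hm ↦
      absurd ((IsLocalRing.maximalIdeal.isMaximal R).eq_of_le hp.ne_top hm ▸ hpq) (fun h ↦
        absurd (IsLocalRing.le_maximalIdeal hq.ne_top) h.not_ge)
    have hfp : f ∈ p := hle (Ideal.mem_sup_left (Ideal.mem_span_singleton_self f))
    obtain ⟨P, hP, hPp, s, hs, hs0, hsP⟩ := hJ p hp (le_sup_right.trans hle)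
    obtain ⟨P', hP', hPp', hlow⟩ := hf p hp hfp
    have hlt : P < p := by
      refine lt_of_le_of_ne hPp ?_
      rintro rfl
      have : P' = P := le_antisymm hPp' (hP.2 hP'.1 hPp')
      exact hlow s hs hs0 (this ▸ hsP)
    exact not_chain_of_ringKrullDim_le_four hdim Ideal.isPrime_bot hs hP.1.1 hp hq hr
      (bot_lt_iff_ne_bot.2 hs0) hsP hlt hpq hqr
  · set S := Localization.Away x
    have hxu : IsUnit (algebraMap R S x) := IsLocalization.Away.algebraMap_isUnit x
    have hcomap : ∀ p : Ideal S, p.IsPrime → x ∉ p.comap (algebraMap R S) := fun p hp h ↦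
      hp.ne_top (Ideal.eq_top_of_isUnit_mem _ h hxu)
    have : IsNoetherianRing S := IsLocalization.isNoetherianRing (.powers x) S inferInstance
    have hmono : ∀ p q : Ideal S, p < q → p.comap (algebraMap R S) < q.comap (algebraMap R S) :=
      fun p q h ↦ (IsLocalization.orderEmbedding (.powers x) S).strictMono h
    have h1 : ExtFiniteOfLow (J.map (algebraMap R S)) := by
      refine extFiniteOfLow_of_dim_le_one fun p q hp hq hJp hpq ↦ ?_
      by_contra hmax
      obtain ⟨m, hm, hqm⟩ := Ideal.exists_le_maximal q hq.ne_top
      have hlt : q < m := lt_of_le_of_ne hqm (by rintro rfl; exact hmax hm)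
      obtain ⟨P, hP, hPp, s, hs, hs0, hsP⟩ :=
        hJ (p.comap (algebraMap R S)) inferInstance (Ideal.map_le_iff_le_comap.1 hJp)
      have hmx : m.comap (algebraMap R S) < IsLocalRing.maximalIdeal R := by
        refine lt_of_le_of_ne (IsLocalRing.le_maximalIdeal (Ideal.IsPrime.ne_top inferInstance)) ?_
        intro h
        exact hcomap m hm.isPrime (h ▸ hx.2)
      exact not_chain_of_ringKrullDim_le_four hdim Ideal.isPrime_bot hs
        (inferInstance : (p.comap (algebraMap R S)).IsPrime) inferInstance inferInstance
        inferInstance (bot_lt_iff_ne_bot.2 hs0) (hsP.trans_le hPp) (hmono _ _ hpq) (hmono _ _ hlt)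
        hmx
    have h2 : ExtFiniteOfLow (Ideal.span {algebraMap R S f}) := extFiniteOfLow_span_singleton _
    have hspan : (Ideal.span {f}).map (algebraMap R S) = Ideal.span {algebraMap R S f} := by
      rw [Ideal.map_span, Set.image_singleton]
    have hsup : Ideal.span {algebraMap R S f} ⊔ J.map (algebraMap R S) = ⊤ := by
      rw [← hspan, ← Ideal.map_sup]
      exact Ideal.eq_top_of_isUnit_mem _ (Ideal.mem_map_of_mem _ hx.1) hxu
    refine ExtFiniteOfLow.of_radical_eq ?_ (ExtFiniteOfLow.mul hsup h2 h1)
    rw [← hspan, ← Ideal.map_mul, ← IsLocalization.map_radical (.powers x),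
      ← IsLocalization.map_radical (.powers x)]
    congr 1
    apply le_antisymm
    · rw [Ideal.radical_eq_sInf I]
      refine le_sInf fun p ⟨hIp, hp⟩ ↦ hp.radical_le_iff.2 (hp.mul_le.2 ?_)
      simpa using hI p hp hIp
    · rw [Ideal.radical_eq_sInf (_ * _)]
      refine le_sInf fun p ⟨hIp, hp⟩ ↦ hp.radical_le_iff.2 ?_
      rcases hp.mul_le.1 hIp with h | h
      · obtain ⟨q, hq, hqp, -⟩ := hf p hp (by simpa using h)
        exact hq.1.2.trans hqp
      · obtain ⟨q, hq, hqp, -⟩ := hJ p hp h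
        exact hq.1.2.trans hqp

end DimensionFour

section TorsionFree

variable {R : Type u} [CommRing R] {I : Ideal R}

lemma ExtFinite.of_torsion_of_torsionfree {J : Ideal R} {A B C : Type u} [AddCommGroup A]
    [Module R A] [AddCommGroup B] [Module R B] [AddCommGroup C] [Module R C]
    {f : A →ₗ[R] B} {g : B →ₗ[R] C} (hf : Function.Injective f)
    (hfg : Function.Exact f g) (hg : Function.Surjective g) (hJ : ExtFiniteOfLow J)
    (hA : IsPowTorsion J A) (hC : Subsingleton (ModuleExt R (R ⧸ J) C 0)) (hB : ExtFinite J B) :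
    ExtFinite J A ∧ ExtFinite J C := by
  have hC0 : IsNoetherian R (ModuleExt R (R ⧸ J) C 0) := inferInstance
  have hA' : ExtFinite J A := hJ A hA (ModuleExt.noeth_post_left_zero hf hfg hg (hB 0))
    (ModuleExt.noeth_post_left hf hfg hg hC0 (hB 1))
  exact ⟨hA', fun j ↦ ModuleExt.noeth_post_right hf hfg hg (hB j) (hA' (j + 1))⟩

lemma ExtFinite.of_acyclic {J : Ideal R} {A B C : Type u} [AddCommGroup A]
    [Module R A] [AddCommGroup B] [Module R B] [AddCommGroup C] [Module R C]
    {f : A →ₗ[R] B} {g : B →ₗ[R] C} (hf : Function.Injective f)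
    (hfg : Function.Exact f g) (hg : Function.Surjective g)
    (hB : ∀ j, Subsingleton (ModuleExt R (R ⧸ J) B j)) (hA : ExtFinite J A) :
    ExtFinite J C := fun j ↦
  have := hB j
  ModuleExt.noeth_post_right hf hfg hg inferInstance (hA (j + 1))

lemma Module.Injective.of_retract {E Q : Type u} [AddCommGroup E] [Module R E] [AddCommGroup Q]
    [Module R Q] (s : Q →ₗ[R] E) (r : E →ₗ[R] Q) (hrs : ∀ x, r (s x) = x)
    (hE : Module.Injective R E) : Module.Injective R Q := by
  refine Module.Baer.injective fun J g ↦ ?_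
  obtain ⟨h, hh⟩ := Module.Baer.of_injective hE J (s ∘ₗ g)
  exact ⟨r ∘ₗ h, fun x hx ↦ by simp [hh x hx, hrs]⟩

lemma injective_powTorsion [IsNoetherianRing R] (I : Ideal R) (E : Type u) [AddCommGroup E]
    [Module R E] (hE : Module.Injective R E) : Module.Injective R (powTorsion I E) := by
  refine Module.Baer.injective fun J g ↦ ?_
  obtain ⟨n, hn⟩ := ((isPowTorsion_powTorsion I E).of_injective _
    (Submodule.subtype_injective (LinearMap.range g))).exists_pow_smul_eq_zero
  obtain ⟨k, hk⟩ := Ideal.exists_pow_inf_eq_pow_smul I (M := R) J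
  have hg : ∀ j : J, (j : R) ∈ I ^ (n + k) → g j = 0 := by
    intro j hj
    have h1 : (j : R) ∈ I ^ n • J := by
      have : (j : R) ∈ I ^ (n + k) • (⊤ : Submodule R R) ⊓ J := ⟨by simpa using hj, j.2⟩
      rw [hk (n + k) (by omega), Nat.add_sub_cancel] at this
      exact Submodule.smul_mono le_rfl inf_le_right this
    have h2 : ∀ x ∈ I ^ n • J, ∀ hx : x ∈ J, g ⟨x, hx⟩ = 0 := by
      intro x hx
      induction hx using Submodule.smul_induction_on' with
      | smul a ha b hb =>
        intro h
        rw [show (⟨a • b, h⟩ : J) = a • ⟨b, hb⟩ from rfl, map_smul]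
        exact congr_arg Subtype.val (hn a ha ⟨g ⟨b, hb⟩, ⟨_, rfl⟩⟩)
      | add x hx y hy h h' =>
        intro hxy
        have hx' : x ∈ J := Submodule.smul_le_right hx
        have hy' : y ∈ J := Submodule.smul_le_right hy
        rw [show (⟨x + y, hxy⟩ : J) = ⟨x, hx'⟩ + ⟨y, hy'⟩ from rfl, map_add, h, h', add_zero]
    exact h2 j h1 j.2
  let φ : J →ₗ[R] R ⧸ I ^ (n + k) := (Submodule.mkQ (I ^ (n + k))) ∘ₗ J.subtype
  have hker : LinearMap.ker φ ≤ LinearMap.ker ((powTorsion I E).subtype ∘ₗ g) := by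
    intro j hj
    have : (j : R) ∈ I ^ (n + k) := (Submodule.Quotient.mk_eq_zero _).1 hj
    simp [hg j this]
  obtain ⟨h, hh⟩ := (Module.Baer.of_injective hE).extension_property
    ((LinearMap.ker φ).liftQ φ le_rfl)
    (LinearMap.ker_eq_bot.1 (Submodule.ker_liftQ_eq_bot _ _ _ le_rfl))
    ((LinearMap.ker φ).liftQ _ hker)
  refine ⟨(h ∘ₗ Submodule.mkQ _).codRestrict _ fun r ↦ ⟨n + k, fun a ha ↦ ?_⟩, fun x hx ↦ ?_⟩
  · rw [LinearMap.comp_apply, ← map_smul, ← map_smul]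
    have : Submodule.mkQ (I ^ (n + k)) (a • r) = 0 :=
      (Submodule.Quotient.mk_eq_zero _).2 (Ideal.mul_mem_right _ _ ha)
    rw [this, map_zero]
  · apply Subtype.ext
    exact LinearMap.congr_fun hh (Submodule.Quotient.mk ⟨x, hx⟩)

lemma injective_quotient_powTorsion [IsNoetherianRing R] (I : Ideal R) (E : Type u)
    [AddCommGroup E] [Module R E] (hE : Module.Injective R E) :
    Module.Injective R (E ⧸ powTorsion I E) := by
  obtain ⟨r, hr⟩ := (Module.Baer.of_injective (injective_powTorsion I E hE)).extension_property
    (powTorsion I E).subtype (Submodule.subtype_injective _) LinearMap.id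
  refine Module.Injective.of_retract ((powTorsion I E).liftQ
    (LinearMap.id - (powTorsion I E).subtype ∘ₗ r) fun x hx ↦ ?_) (powTorsion I E).mkQ ?_ hE
  · have := LinearMap.congr_fun hr ⟨x, hx⟩
    simp only [LinearMap.comp_apply, Submodule.subtype_apply, LinearMap.id_apply] at this
    simp [this]
  · intro x
    obtain ⟨x, rfl⟩ := Submodule.mkQ_surjective _ x
    simp

lemma eq_zero_of_smul_eq_zero_quotient_powTorsion [IsNoetherianRing R] {T : Type u}
    [AddCommGroup T] [Module R T] (t : T ⧸ powTorsion I T) (ht : ∀ a ∈ I, a • t = 0) : t = 0 := by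
  obtain ⟨t, rfl⟩ := Submodule.mkQ_surjective _ t
  let φ : I →ₗ[R] T := LinearMap.toSpanSingleton R T t ∘ₗ I.subtype
  have hφ : LinearMap.range φ ≤ powTorsion I T := by
    rintro _ ⟨a, rfl⟩
    exact (Submodule.Quotient.mk_eq_zero _).1 (ht a a.2)
  obtain ⟨n, hn⟩ := ((isPowTorsion_powTorsion I T).of_injective (Submodule.inclusion hφ)
    (Submodule.inclusion_injective hφ)).exists_pow_smul_eq_zero
  refine (Submodule.Quotient.mk_eq_zero _).2 ⟨n + 1, fun a ha ↦ ?_⟩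
  rw [pow_succ, ← smul_eq_mul] at ha
  induction ha using Submodule.smul_induction_on' with
  | smul a ha b hb =>
    rw [smul_eq_mul, mul_smul]
    exact congr_arg Subtype.val (hn a ha ⟨φ ⟨b, hb⟩, ⟨_, rfl⟩⟩)
  | add x _ y _ hx hy => rw [add_smul, hx, hy, add_zero]

lemma Ideal.Quotient.mk_eq_smul_one (J : Ideal R) (x : R) :
    Ideal.Quotient.mk J x = x • (1 : R ⧸ J) := by
  rw [Algebra.smul_def, mul_one]; rfl

lemma subsingleton_ext_zero_localizedModule [IsNoetherianRing R] (U : Submonoid R) {T : Type u}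
    [AddCommGroup T] [Module R T] (hT : ∀ t : T, (∀ a ∈ I, a • t = 0) → t = 0) :
    Subsingleton (ModuleExt (Localization U)
      (Localization U ⧸ I.map (algebraMap R (Localization U))) (LocalizedModule U T) 0) := by
  have : Subsingleton ((Localization U ⧸ I.map (algebraMap R (Localization U))) →ₗ[Localization U]
      LocalizedModule U T) := by
    refine subsingleton_of_forall_eq 0 fun f ↦ ?_
    have h1 : ∀ a ∈ I, a • f 1 = 0 := fun a ha ↦ by
      rw [← algebraMap_smul (Localization U) a (f 1), ← map_smul]
      have : algebraMap R (Localization U) a • (1 : Localization U ⧸ I.map (algebraMap R (Localization U))) = 0 := by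
        rw [← Ideal.Quotient.mk_eq_smul_one]
        exact Ideal.Quotient.eq_zero_iff_mem.2 (Ideal.mem_map_of_mem _ ha)
      rw [this, map_zero]
    obtain ⟨s, hs, v, hv, hvs⟩ := exists_mk_eq_of_mem_torsionBySet U (IsNoetherian.noetherian I) h1
    rw [Submodule.mem_torsionBySet_iff] at hs
    rw [hT s fun a ha ↦ hs ⟨a, ha⟩, map_zero] at hvs
    have h2 : f 1 = 0 := by
      have := (Module.End.isUnit_iff _).1
        (IsLocalizedModule.map_units (LocalizedModule.mkLinearMap U T) ⟨v, hv⟩)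
      exact this.1 (by simpa using hvs)
    refine LinearMap.ext fun x ↦ ?_
    obtain ⟨x, rfl⟩ := Ideal.Quotient.mk_surjective x
    rw [Ideal.Quotient.mk_eq_smul_one, map_smul, h2, smul_zero, LinearMap.zero_apply]
  exact ModuleExt.zeroEquiv.toEquiv.subsingleton

/-- Localizations of the torsion-free part of an injective module are acyclic. -/
lemma subsingleton_ext_localizedModule [IsNoetherianRing R] (I : Ideal R) (U : Submonoid R)
    {E : Type u} [AddCommGroup E] [Module R E] (hE : Module.Injective R E) (j : ℕ) :
    Subsingleton (ModuleExt (Localization U)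
      (Localization U ⧸ I.map (algebraMap R (Localization U)))
      (LocalizedModule U (E ⧸ powTorsion I E)) j) := by
  cases j with
  | zero => exact subsingleton_ext_zero_localizedModule U eq_zero_of_smul_eq_zero_quotient_powTorsion
  | succ j =>
    have := injective_quotient_powTorsion I E hE
    have := Module.injective_of_isLocalizedModule U (Rₛ := Localization U)
      (LocalizedModule.mkLinearMap U (E ⧸ powTorsion I E))
    have := Module.injective_object_of_injective_module (Localization U)
      (LocalizedModule U (E ⧸ powTorsion I E))
    exact ModuleExt.subsingleton_of_injective j

end TorsionFree

section LocalCohomology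

variable {R : Type u} [CommRing R] (I : Ideal R)

/-- The projection `R/I^m → R/I^n` for `n ≤ m`. -/
def quotientPowMap {n m : ℕ} (h : n ≤ m) : (R ⧸ I ^ m) →ₗ[R] (R ⧸ I ^ n) :=
  Submodule.mapQ _ _ LinearMap.id (Ideal.pow_le_pow_right h)

/-- `A` is the colimit of the modules `Ext^i(R/I^n, M)`. -/
def IsLocalCohomology (i : ℕ) (M A : Type u) [AddCommGroup M] [Module R M] [AddCommGroup A]
    [Module R A] : Prop :=
  ∃ ψ : ∀ n : ℕ, ModuleExt R (R ⧸ I ^ n) M i →ₗ[R] A,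
    (∀ n m (h : n ≤ m) e, ψ m (ModuleExt.pre M (quotientPowMap I h) i e) = ψ n e) ∧
    (∀ a, ∃ n e, ψ n e = a) ∧
    ∀ n e, ψ n e = 0 → ∃ m, ∃ h : n ≤ m, ModuleExt.pre M (quotientPowMap I h) i e = 0

variable {I}

lemma IsLocalCohomology.isPowTorsion {i : ℕ} {M A : Type u} [AddCommGroup M] [Module R M]
    [AddCommGroup A] [Module R A] (h : IsLocalCohomology I i M A) : IsPowTorsion I A := fun a ↦ by
  obtain ⟨ψ, -, hs, -⟩ := h
  obtain ⟨n, e, rfl⟩ := hs a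
  refine ⟨n, fun a ha ↦ ?_⟩
  rw [← map_smul, ModuleExt.smul_eq_zero_of_smul_eq_zero (fun x ↦ smul_quotient_eq_zero ha x),
    map_zero]

lemma ModuleExt.pre_postδ {A B C X Y : Type u} [AddCommGroup A] [Module R A] [AddCommGroup B]
    [Module R B] [AddCommGroup C] [Module R C] [AddCommGroup X] [Module R X] [AddCommGroup Y]
    [Module R Y] {f : A →ₗ[R] B} {g : B →ₗ[R] C} (hf : Function.Injective f)
    (hfg : Function.Exact f g) (hg : Function.Surjective g) (k : X →ₗ[R] Y) (n : ℕ)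
    (e : ModuleExt R Y C n) :
    pre A k (n + 1) (postδ hf hfg hg Y n e) = postδ hf hfg hg X n (pre C k n e) := by
  change (Abelian.Ext.mk₀ (ModuleCat.ofHom k)).comp (e.comp (shortExact hf hfg hg).extClass rfl)
    (zero_add (n + 1)) = ((Abelian.Ext.mk₀ (ModuleCat.ofHom k)).comp e (zero_add n)).comp
      (shortExact hf hfg hg).extClass rfl
  rw [Abelian.Ext.comp_assoc _ _ _ (zero_add n) rfl (by omega)]

section Torsion

variable {T : Type u} [AddCommGroup T] [Module R T]

lemma liftQ_toSpanSingleton_one (J : Ideal R) (t : T)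
    (h : J ≤ LinearMap.ker (LinearMap.toSpanSingleton R T t)) :
    Submodule.liftQ J (LinearMap.toSpanSingleton R T t) h (1 : R ⧸ J) = t :=
  one_smul R t

variable (I T) in
/-- The identification of the `I^n`-torsion of `T` with `Ext⁰(R/I^n, T)`. -/
def torsionToExt (n : ℕ) :
    Submodule.torsionBySet R T (I ^ n : Ideal R) →ₗ[R] ModuleExt R (R ⧸ I ^ n) T 0 :=
  ModuleExt.zeroEquiv.symm.toLinearMap ∘ₗ
    { toFun t := Submodule.liftQ (I ^ n) (LinearMap.toSpanSingleton R T t) fun a ha ↦ by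
        simpa using (Submodule.mem_torsionBySet_iff _ _).1 t.2 ⟨a, ha⟩
      map_add' s t := by
        apply Submodule.linearMap_qext
        ext
        simp [liftQ_toSpanSingleton_one]
      map_smul' a t := by
        apply Submodule.linearMap_qext
        ext
        simp [liftQ_toSpanSingleton_one] }

lemma torsionToExt_apply (n : ℕ) (t : Submodule.torsionBySet R T (I ^ n : Ideal R)) :
    torsionToExt I T n t = Abelian.Ext.mk₀ (ModuleCat.ofHom (Submodule.liftQ (I ^ n)
      (LinearMap.toSpanSingleton R T t) fun a ha ↦ by
        simpa using (Submodule.mem_torsionBySet_iff _ _).1 t.2 ⟨a, ha⟩)) := rfl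

lemma torsionToExt_injective (n : ℕ) : Function.Injective (torsionToExt I T n) := by
  refine ModuleExt.zeroEquiv.symm.injective.comp fun s t h ↦ Subtype.ext ?_
  simpa [liftQ_toSpanSingleton_one] using LinearMap.congr_fun h (Submodule.Quotient.mk 1)

lemma torsionToExt_surjective (n : ℕ) : Function.Surjective (torsionToExt I T n) := by
  refine ModuleExt.zeroEquiv.symm.surjective.comp fun f ↦ ⟨⟨f (Submodule.Quotient.mk 1), ?_⟩, ?_⟩
  · rw [Submodule.mem_torsionBySet_iff]
    rintro ⟨a, ha⟩
    change a • f _ = 0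
    rw [← map_smul, smul_quotient_eq_zero ha, map_zero]
  · apply Submodule.linearMap_qext
    ext
    simp

lemma pre_torsionToExt {n m : ℕ} (h : n ≤ m) (t : T)
    (hn : t ∈ Submodule.torsionBySet R T (I ^ n : Ideal R))
    (hm : t ∈ Submodule.torsionBySet R T (I ^ m : Ideal R)) :
    ModuleExt.pre T (quotientPowMap I h) 0 (torsionToExt I T n ⟨t, hn⟩) =
      torsionToExt I T m ⟨t, hm⟩ := by
  rw [torsionToExt_apply, torsionToExt_apply, ModuleExt.pre_apply, Abelian.Ext.mk₀_comp_mk₀,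
    ← ModuleCat.ofHom_comp]
  congr 2
  apply Submodule.linearMap_qext
  ext
  simp [quotientPowMap, liftQ_toSpanSingleton_one]

lemma post_torsionToExt {T' : Type u} [AddCommGroup T'] [Module R T'] (f : T →ₗ[R] T') {n : ℕ}
    (t : T) (hn : t ∈ Submodule.torsionBySet R T (I ^ n : Ideal R))
    (hn' : f t ∈ Submodule.torsionBySet R T' (I ^ n : Ideal R)) :
    ModuleExt.post _ f 0 (torsionToExt I T n ⟨t, hn⟩) = torsionToExt I T' n ⟨f t, hn'⟩ := by
  rw [torsionToExt_apply, torsionToExt_apply, ModuleExt.post_apply, Abelian.Ext.mk₀_comp_mk₀,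
    ← ModuleCat.ofHom_comp]
  congr 2
  apply Submodule.linearMap_qext
  ext
  simp [liftQ_toSpanSingleton_one]

lemma mem_torsionBySet_pow_of_le {n m : ℕ} (h : n ≤ m) {t : T}
    (ht : t ∈ Submodule.torsionBySet R T (I ^ n : Ideal R)) :
    t ∈ Submodule.torsionBySet R T (I ^ m : Ideal R) :=
  Submodule.torsionBySet_le_torsionBySet_of_subset (Ideal.pow_le_pow_right h) ht

lemma mem_powTorsion_iff_torsionBySet {t : T} :
    t ∈ powTorsion I T ↔ ∃ n : ℕ, t ∈ Submodule.torsionBySet R T (I ^ n : Ideal R) := by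
  simp [mem_powTorsion, Submodule.mem_torsionBySet_iff]

lemma exists_linearMap_powTorsion {A : Type u} [AddCommGroup A] [Module R A]
    (θ : ∀ n, Submodule.torsionBySet R T (I ^ n : Ideal R) →ₗ[R] A)
    (hθ : ∀ n m, n ≤ m → ∀ t ht ht', θ n ⟨t, ht⟩ = θ m ⟨t, ht'⟩) :
    ∃ Θ : powTorsion I T →ₗ[R] A, ∀ n t ht ht', Θ ⟨t, ht'⟩ = θ n ⟨t, ht⟩ := by
  choose k hk using fun t : powTorsion I T ↦ mem_powTorsion_iff_torsionBySet.1 t.2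
  have key : ∀ t : powTorsion I T, ∀ n ht, θ (k t) ⟨t, hk t⟩ = θ n ⟨t, ht⟩ := fun t n ht ↦ by
    rcases le_total (k t) n with h | h
    · exact hθ _ _ h _ _ _
    · exact (hθ _ _ h _ _ _).symm
  refine ⟨{ toFun t := θ (k t) ⟨t, hk t⟩
            map_add' s t := ?_
            map_smul' a t := ?_ }, fun n t ht ht' ↦ key ⟨t, ht'⟩ n ht⟩
  · have hs := mem_torsionBySet_pow_of_le (le_max_left (k s) (k t)) (hk s)
    have ht := mem_torsionBySet_pow_of_le (le_max_right (k s) (k t)) (hk t)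
    rw [key s _ hs, key t _ ht, key (s + t) _ (add_mem hs ht), ← map_add]
    rfl
  · rw [key (a • t) (k t) (Submodule.smul_mem _ a (hk t)), RingHom.id_apply, ← map_smul]
    rfl

end Torsion

variable {M A : Type u} [AddCommGroup M] [Module R M] [AddCommGroup A] [Module R A]

/-- The zeroth local cohomology is the torsion submodule. -/
lemma IsLocalCohomology.nonempty_equiv_powTorsion (h : IsLocalCohomology I 0 M A) :
    Nonempty (powTorsion I M ≃ₗ[R] A) := by
  obtain ⟨ψ, hc, hs, hk⟩ := h
  obtain ⟨Θ, hΘ⟩ := exists_linearMap_powTorsion (fun n ↦ ψ n ∘ₗ torsionToExt I M n)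
    fun n m h t ht ht' ↦ by
      rw [LinearMap.comp_apply, LinearMap.comp_apply, ← hc n m h, pre_torsionToExt h t ht ht']
  refine ⟨LinearEquiv.ofBijective Θ ⟨?_, ?_⟩⟩
  · refine LinearMap.ker_eq_bot.1 ((Submodule.eq_bot_iff _).2 fun t ht ↦ ?_)
    obtain ⟨t, htm⟩ := t
    obtain ⟨n, hn⟩ := mem_powTorsion_iff_torsionBySet.1 htm
    rw [LinearMap.mem_ker, hΘ n t hn] at ht
    obtain ⟨m, h, hm⟩ := hk n _ ht
    have hn' := mem_torsionBySet_pow_of_le h hn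
    rw [pre_torsionToExt h t hn hn', LinearMap.map_eq_zero_iff _ (torsionToExt_injective m)] at hm
    exact Subtype.ext (Subtype.ext_iff.1 hm :)
  · intro a
    obtain ⟨n, e, rfl⟩ := hs a
    obtain ⟨t, rfl⟩ := torsionToExt_surjective n e
    exact ⟨⟨t, mem_powTorsion_iff_torsionBySet.2 ⟨n, t.2⟩⟩, hΘ n t t.2 _⟩

variable {E L : Type u} [AddCommGroup E] [Module R E] [AddCommGroup L] [Module R L]
  {ι : M →ₗ[R] E} {π : E →ₗ[R] L}

/-- Dimension shifting for local cohomology. -/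
lemma IsLocalCohomology.of_injective (hι : Function.Injective ι) (hιπ : Function.Exact ι π)
    (hπ : Function.Surjective π) (hE : Module.Injective R E) {i : ℕ}
    (h : IsLocalCohomology I (i + 2) M A) : IsLocalCohomology I (i + 1) L A := by
  have := Module.injective_object_of_injective_module R E
  obtain ⟨ψ, hc, hs, hk⟩ := h
  refine ⟨fun n ↦ ψ n ∘ₗ ModuleExt.postδ hι hιπ hπ _ (i + 1), fun n m h e ↦ ?_, fun a ↦ ?_,
    fun n e he ↦ ?_⟩
  · rw [LinearMap.comp_apply, LinearMap.comp_apply, ← ModuleExt.pre_postδ, hc]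
  · obtain ⟨n, e, rfl⟩ := hs a
    have := ModuleExt.subsingleton_of_injective (S := R) (X := R ⧸ I ^ n) (T := E) (i + 1)
    obtain ⟨e, rfl⟩ := (ModuleExt.postδ_post_exact hι hιπ hπ (i + 1) e).1 (Subsingleton.elim _ _)
    exact ⟨n, e, rfl⟩
  · obtain ⟨m, h, hm⟩ := hk n _ he
    refine ⟨m, h, ?_⟩
    rw [ModuleExt.pre_postδ] at hm
    obtain ⟨e', he'⟩ := (ModuleExt.post_postδ_exact hι hιπ hπ (i + 1) _).1 hm
    have := ModuleExt.subsingleton_of_injective (S := R) (X := R ⧸ I ^ m) (T := E) i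
    rw [← he', Subsingleton.elim e' 0, map_zero]

lemma map_powTorsion_le (f : E →ₗ[R] L) : (powTorsion I E).map f ≤ powTorsion I L := by
  rintro _ ⟨t, ⟨n, hn⟩, rfl⟩
  exact ⟨n, fun a ha ↦ by rw [← map_smul, hn a ha, map_zero]⟩

/-- The first local cohomology in terms of an injective hull. -/
lemma IsLocalCohomology.nonempty_equiv_ker_factor (hι : Function.Injective ι)
    (hιπ : Function.Exact ι π) (hπ : Function.Surjective π) (hE : Module.Injective R E)
    (h : IsLocalCohomology I 1 M A) :
    Nonempty (LinearMap.ker (Submodule.factor (map_powTorsion_le (I := I) π)) ≃ₗ[R] A) := by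
  have := Module.injective_object_of_injective_module R E
  obtain ⟨ψ, hc, hs, hk⟩ := h
  obtain ⟨Θ, hΘ⟩ := exists_linearMap_powTorsion
    (fun n ↦ ψ n ∘ₗ ModuleExt.postδ hι hιπ hπ _ 0 ∘ₗ torsionToExt I L n)
    fun n m h t ht ht' ↦ by
      simp only [LinearMap.comp_apply]
      rw [← hc n m h, ModuleExt.pre_postδ, pre_torsionToExt h t ht ht']
  have hsurj : Function.Surjective Θ := by
    intro a
    obtain ⟨n, e, rfl⟩ := hs a
    have := ModuleExt.subsingleton_of_injective (S := R) (X := R ⧸ I ^ n) (T := E) 0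
    obtain ⟨e, rfl⟩ := (ModuleExt.postδ_post_exact hι hιπ hπ 0 e).1 (Subsingleton.elim _ _)
    obtain ⟨t, rfl⟩ := torsionToExt_surjective n e
    exact ⟨⟨t, mem_powTorsion_iff_torsionBySet.2 ⟨n, t.2⟩⟩, hΘ n t t.2 _⟩
  have hker : ∀ t : powTorsion I L, Θ t = 0 ↔ (t : L) ∈ (powTorsion I E).map π := by
    rintro ⟨t, htm⟩
    constructor
    · intro ht
      obtain ⟨n, hn⟩ := mem_powTorsion_iff_torsionBySet.1 htm
      rw [hΘ n t hn] at ht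
      obtain ⟨m, h, hm⟩ := hk n _ ht
      have hn' := mem_torsionBySet_pow_of_le h hn
      rw [LinearMap.comp_apply, ModuleExt.pre_postδ, pre_torsionToExt h t hn hn'] at hm
      obtain ⟨e, he⟩ := (ModuleExt.post_postδ_exact hι hιπ hπ 0 _).1 hm
      obtain ⟨s, rfl⟩ := torsionToExt_surjective m e
      have hs' : π s ∈ Submodule.torsionBySet R L (I ^ m : Ideal R) := by
        have hs := s.2
        rw [Submodule.mem_torsionBySet_iff] at hs ⊢
        intro a
        have := congr_arg π (hs a)
        simpa using this
      have h1 : torsionToExt I L m ⟨π s, hs'⟩ = torsionToExt I L m ⟨t, hn'⟩ := by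
        rw [← he, ← post_torsionToExt π s s.2 hs']
      exact ⟨s, mem_powTorsion_iff_torsionBySet.2 ⟨m, s.2⟩,
        congr_arg Subtype.val (torsionToExt_injective m h1)⟩
    · rintro ⟨s, hs, hst⟩
      obtain rfl : π s = t := hst
      obtain ⟨n, hn⟩ := mem_powTorsion_iff_torsionBySet.1 hs
      have hn' : π s ∈ Submodule.torsionBySet R L (I ^ n : Ideal R) := by
        rw [Submodule.mem_torsionBySet_iff] at hn ⊢
        intro a
        have := congr_arg π (hn a)
        simpa using this
      rw [hΘ n _ hn', LinearMap.comp_apply, LinearMap.comp_apply, ← post_torsionToExt π s hn hn',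
        (ModuleExt.post_postδ_exact hι hιπ hπ 0 _).2 ⟨_, rfl⟩, map_zero]
  let φ : powTorsion I L →ₗ[R] LinearMap.ker (Submodule.factor (map_powTorsion_le (I := I) π)) :=
    (((powTorsion I E).map π).mkQ ∘ₗ (powTorsion I L).subtype).codRestrict _ fun t ↦ by
      rw [LinearMap.mem_ker]
      exact (Submodule.Quotient.mk_eq_zero _).2 t.2
  have hφs : Function.Surjective φ := by
    rintro ⟨t, ht⟩
    obtain ⟨t, rfl⟩ := Submodule.mkQ_surjective _ t
    exact ⟨⟨t, (Submodule.Quotient.mk_eq_zero _).1 ht⟩, rfl⟩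
  have hφk : LinearMap.ker φ = LinearMap.ker Θ := by
    ext t
    rw [LinearMap.mem_ker, LinearMap.mem_ker, hker, ← Submodule.Quotient.mk_eq_zero]
    exact ⟨fun h ↦ congr_arg Subtype.val h, fun h ↦ Subtype.ext h⟩
  exact ⟨(φ.quotKerEquivOfSurjective hφs).symm ≪≫ₗ Submodule.quotEquivOfEq _ _ hφk ≪≫ₗ
    Θ.quotKerEquivOfSurjective hsurj⟩

end LocalCohomology

section Recursion

variable {R : Type u} [CommRing R] {I : Ideal R}

lemma ExtFinite.of_linearEquiv {J : Ideal R} {A B : Type u} [AddCommGroup A] [Module R A]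
    [AddCommGroup B] [Module R B] (e : A ≃ₗ[R] B) (hA : ExtFinite J A) : ExtFinite J B := fun j ↦
  have := hA j
  isNoetherian_of_linearEquiv (ModuleExt.postEquiv (R ⧸ J) e j)

/-- Localization of a linear equivalence. -/
def localizedEquiv (U : Submonoid R) {A B : Type u} [AddCommGroup A] [Module R A]
    [AddCommGroup B] [Module R B] (e : A ≃ₗ[R] B) :
    LocalizedModule U A ≃ₗ[Localization U] LocalizedModule U B :=
  LinearEquiv.ofBijective (LocalizedModule.map U e.toLinearMap)
    ⟨LocalizedModule.map_injective U _ e.injective, LocalizedModule.map_surjective U _ e.surjective⟩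

lemma localizedModule_map_exact (U : Submonoid R) {A B C : Type u} [AddCommGroup A] [Module R A]
    [AddCommGroup B] [Module R B] [AddCommGroup C] [Module R C] {f : A →ₗ[R] B} {g : B →ₗ[R] C}
    (h : Function.Exact f g) :
    Function.Exact (LocalizedModule.map U f) (LocalizedModule.map U g) := by
  exact LocalizedModule.map_exact U f g h

variable {M E L : Type u} [AddCommGroup M] [Module R M] [AddCommGroup E] [Module R E]
  [AddCommGroup L] [Module R L] {ι : M →ₗ[R] E} {π : E →ₗ[R] L}

lemma extFinite_localizedModule_step [IsNoetherianRing R] (U : Submonoid R)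
    (hI : ExtFiniteOfLow (I.map (algebraMap R (Localization U))))
    (hι : Function.Injective ι) (hιπ : Function.Exact ι π)
    (hπ : Function.Surjective π) (hE : Module.Injective R E)
    (hM : ExtFinite (I.map (algebraMap R (Localization U)))
      (LocalizedModule U (M ⧸ powTorsion I M))) :
    ExtFinite (I.map (algebraMap R (Localization U))) (LocalizedModule U
      (LinearMap.ker (Submodule.factor (map_powTorsion_le (I := I) π)))) ∧
    ExtFinite (I.map (algebraMap R (Localization U)))
      (LocalizedModule U (L ⧸ powTorsion I L)) := by
  let α : (M ⧸ powTorsion I M) →ₗ[R] (E ⧸ powTorsion I E) :=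
    Submodule.mapQ _ _ ι (Submodule.map_le_iff_le_comap.1 (map_powTorsion_le ι))
  let β : (E ⧸ powTorsion I E) →ₗ[R] (L ⧸ (powTorsion I E).map π) :=
    Submodule.mapQ _ _ π (Submodule.map_le_iff_le_comap.1 le_rfl)
  have hα : Function.Injective α := by
    refine LinearMap.ker_eq_bot.1 ((Submodule.eq_bot_iff _).2 fun t ht ↦ ?_)
    obtain ⟨t, rfl⟩ := Submodule.mkQ_surjective _ t
    obtain ⟨n, hn⟩ := (Submodule.Quotient.mk_eq_zero _).1 ht
    exact (Submodule.Quotient.mk_eq_zero _).2 ⟨n, fun a ha ↦ hι (by simp [hn a ha])⟩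
  have hβ : Function.Surjective β := by
    intro t
    obtain ⟨t, rfl⟩ := Submodule.mkQ_surjective _ t
    obtain ⟨e, rfl⟩ := hπ t
    exact ⟨Submodule.Quotient.mk e, rfl⟩
  have hαβ : Function.Exact α β := by
    intro t
    constructor
    · obtain ⟨t, rfl⟩ := Submodule.mkQ_surjective _ t
      intro ht
      obtain ⟨e, he, het⟩ := (Submodule.Quotient.mk_eq_zero _).1 ht
      obtain ⟨m, hm⟩ := (hιπ (t - e)).1 (by rw [map_sub, het, sub_self])
      refine ⟨Submodule.Quotient.mk m, ?_⟩
      refine (Submodule.Quotient.eq _).2 ?_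
      rw [hm, sub_sub_cancel_left]
      exact neg_mem he
    · rintro ⟨m, rfl⟩
      obtain ⟨m, rfl⟩ := Submodule.mkQ_surjective _ m
      refine (Submodule.Quotient.mk_eq_zero _).2 ?_
      rw [hιπ.apply_apply_eq_zero]
      exact zero_mem _
  have hL' := ExtFinite.of_acyclic (LocalizedModule.map_injective U α hα)
    (localizedModule_map_exact U hαβ) (LocalizedModule.map_surjective U β hβ)
    (subsingleton_ext_localizedModule I U hE) hM
  set γ := Submodule.factor (map_powTorsion_le (I := I) π)
  have hγ : Function.Surjective γ := Submodule.factor_surjective _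
  refine ExtFinite.of_torsion_of_torsionfree
    (LocalizedModule.map_injective U _ (Submodule.subtype_injective (LinearMap.ker γ)))
    (localizedModule_map_exact U (LinearMap.exact_subtype_ker_map γ))
    (LocalizedModule.map_surjective U γ hγ) hI (IsPowTorsion.localizedModule U ?_)
    (subsingleton_ext_zero_localizedModule U eq_zero_of_smul_eq_zero_quotient_powTorsion) hL'
  rintro ⟨t, ht⟩
  obtain ⟨t, rfl⟩ := Submodule.mkQ_surjective _ t
  obtain ⟨n, hn⟩ := (Submodule.Quotient.mk_eq_zero _).1 ht
  refine ⟨n, fun a ha ↦ Subtype.ext ?_⟩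
  change a • Submodule.mkQ _ t = 0
  rw [← map_smul, show a • t = 0 from hn a ha, map_zero]

lemma exists_injective_embedding (M : Type u) [AddCommGroup M] [Module R M] :
    ∃ (E : Type u) (_ : AddCommGroup E) (_ : Module R E) (ι : M →ₗ[R] E),
      Function.Injective ι ∧ Module.Injective R E := by
  let E := CategoryTheory.Injective.under (ModuleCat.of R M)
  have : CategoryTheory.Injective (ModuleCat.of R E) :=
    inferInstanceAs (CategoryTheory.Injective (CategoryTheory.Injective.under (ModuleCat.of R M)))
  exact ⟨E, inferInstance, inferInstance, (CategoryTheory.Injective.ι (ModuleCat.of R M)).hom,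
    (ModuleCat.mono_iff_injective _).1 inferInstance,
    Module.injective_module_of_injective_object R E⟩

lemma extFinite_localizedModule_of_isLocalCohomology [IsNoetherianRing R] (U : Submonoid R)
    (hI : ExtFiniteOfLow (I.map (algebraMap R (Localization U)))) (i : ℕ) :
    ∀ (M A : Type u) [AddCommGroup M] [Module R M] [AddCommGroup A] [Module R A],
      ExtFinite (I.map (algebraMap R (Localization U))) (LocalizedModule U (M ⧸ powTorsion I M)) →
      IsLocalCohomology I (i + 1) M A →
      ExtFinite (I.map (algebraMap R (Localization U))) (LocalizedModule U A) := by
  induction i with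
  | zero =>
    intro M A _ _ _ _ hM hA
    obtain ⟨E, _, _, ι, hι, hE⟩ := exists_injective_embedding (R := R) M
    have hιπ := LinearMap.exact_map_mkQ_range ι
    have hπ := Submodule.mkQ_surjective (LinearMap.range ι)
    obtain ⟨e⟩ := hA.nonempty_equiv_ker_factor hι hιπ hπ hE
    exact (extFinite_localizedModule_step U hI hι hιπ hπ hE hM).1.of_linearEquiv
      (localizedEquiv U e)
  | succ i ih =>
    intro M A _ _ _ _ hM hA
    obtain ⟨E, _, _, ι, hι, hE⟩ := exists_injective_embedding (R := R) M
    have hιπ := LinearMap.exact_map_mkQ_range ι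
    have hπ := Submodule.mkQ_surjective (LinearMap.range ι)
    exact ih _ A (extFinite_localizedModule_step U hI hι hιπ hπ hE hM).2
      (hA.of_injective hι hιπ hπ hE)

theorem extFinite_localizedModule [IsNoetherianRing R] (U : Submonoid R)
    (hI : ExtFiniteOfLow (I.map (algebraMap R (Localization U)))) (i : ℕ)
    (M A : Type u) [AddCommGroup M] [Module R M] [Module.Finite R M] [AddCommGroup A] [Module R A]
    (hA : IsLocalCohomology I i M A) :
    ExtFinite (I.map (algebraMap R (Localization U))) (LocalizedModule U A) := by
  have : IsNoetherianRing (Localization U) := IsLocalization.isNoetherianRing U _ inferInstance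
  have hfin : ∀ (N : Type u) [AddCommGroup N] [Module R N] [Module.Finite R N],
      ExtFinite (I.map (algebraMap R (Localization U))) (LocalizedModule U N) := fun N _ _ _ ↦ by
    have := Module.Finite.of_isLocalizedModule U (Rₚ := Localization U)
      (LocalizedModule.mkLinearMap U N)
    exact extFinite_of_isNoetherian _ inferInstance
  cases i with
  | zero =>
    obtain ⟨e⟩ := hA.nonempty_equiv_powTorsion
    exact (hfin (powTorsion I M)).of_linearEquiv (localizedEquiv U e)
  | succ i =>
    exact extFinite_localizedModule_of_isLocalCohomology U hI i M A (hfin _) hA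

lemma IsPowTorsion.support_subset {J : Ideal R} {A : Type u}
    [AddCommGroup A] [Module R A] (hA : IsPowTorsion J A) :
    Module.support R A ⊆ PrimeSpectrum.zeroLocus (J : Set R) := by
  intro p hp
  rw [Module.mem_support_iff_exists_annihilator] at hp
  obtain ⟨a, ha⟩ := hp
  obtain ⟨n, hn⟩ := hA a
  refine fun x hx ↦ p.2.mem_of_pow_mem n (ha ?_)
  rw [Submodule.mem_annihilator_span_singleton]
  exact hn _ (Ideal.pow_mem_pow hx n)

end Recursion

section OppositeHomology

variable {S : Type u} [CommRing S] {ι : Type*} {c : ComplexShape ι}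
  (K : HomologicalComplex (ModuleCat.{u} S)ᵒᵖ c)

lemma pOpcycles_unop_injective (n : ι) : Function.Injective (K.pOpcycles n).unop.hom :=
  (ModuleCat.mono_iff_injective _).1 inferInstance

lemma homologyι_unop_surjective (n : ι) : Function.Surjective (K.homologyι n).unop.hom :=
  (ModuleCat.epi_iff_surjective _).1 inferInstance

lemma pOpcycles_unop_exact (m n : ι) (h : c.prev n = m) :
    Function.Exact (K.pOpcycles n).unop.hom (K.d m n).unop.hom := by
  have := (ShortComplex.exact_of_g_is_cokernel (ShortComplex.mk _ _ (K.d_pOpcycles m n))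
    (K.opcyclesIsCokernel m n h)).unop
  exact (ShortComplex.ShortExact.moduleCat_exact_iff_function_exact _).1 this

lemma homologyι_unop_exact (n p : ι) (h : c.next n = p) :
    Function.Exact (K.fromOpcycles n p).unop.hom (K.homologyι n).unop.hom := by
  have := (ShortComplex.exact_of_f_is_kernel
    (ShortComplex.mk _ _ (K.homologyι_comp_fromOpcycles n p)) (K.homologyIsKernel n p h)).unop
  exact (ShortComplex.ShortExact.moduleCat_exact_iff_function_exact _).1 this

end OppositeHomology

section ExtComparison

open Opposite

variable {S : Type u} [CommRing S] {X : ModuleCat.{u} S} (P : ProjectiveResolution X)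
  (Y : ModuleCat.{u} S) (n : ℕ)

lemma extMk_eq_zero_iff_next (f : P.complex.X n ⟶ Y) (hf : P.complex.d (n + 1) n ≫ f = 0) :
    P.extMk f (n + 1) rfl hf = 0 ↔
      ∃ g : P.complex.X ((ComplexShape.down ℕ).next n) ⟶ Y, P.complex.d n _ ≫ g = f := by
  obtain _ | n := n
  · constructor
    · intro h
      rw [← P.extEquivCohomologyClass.apply_eq_iff_eq, P.extEquivCohomologyClass_extMk,
        P.extEquivCohomologyClass_zero,
        CochainComplex.HomComplex.CohomologyClass.mk_eq_zero_iff,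
        CochainComplex.HomComplex.Cocycle.toSingleMk_mem_coboundaries_iff _ _ _ _ _ 1
          (by simp)] at h
      obtain ⟨g, hg⟩ := h
      have h0 : g = 0 :=
        (CochainComplex.isZero_of_isStrictlyLE P.cochainComplex 0 1 (by simp)).eq_of_src _ _
      refine ⟨0, ?_⟩
      rw [h0, Limits.comp_zero] at hg
      rw [Limits.comp_zero]
      exact ((cancel_epi _).1 (hg.symm.trans Limits.comp_zero.symm)).symm
    · rintro ⟨g, rfl⟩
      simp
  · rw [P.extMk_eq_zero_iff f _ rfl hf n rfl, ChainComplex.next_nat_succ]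

/-- The complex of homomorphisms from a projective resolution, as a chain complex in the
opposite category. -/
abbrev homComplexOp : ChainComplex (ModuleCat.{u} S)ᵒᵖ ℕ :=
  (((linearYoneda S (ModuleCat.{u} S)).obj Y).rightOp.mapHomologicalComplex _).obj P.complex

/-- The cocycle underlying an element of the dual of the opcycles. -/
def cocycleOfOpcycles (z : ((homComplexOp P Y).opcycles n).unop) : P.complex.X n ⟶ Y :=
  ((homComplexOp P Y).pOpcycles n).unop.hom z

variable {Y n} in
lemma d_comp_cocycleOfOpcycles (z : ((homComplexOp P Y).opcycles n).unop) :
    P.complex.d (n + 1) n ≫ cocycleOfOpcycles P Y n z = 0 :=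
  (pOpcycles_unop_exact (homComplexOp P Y) (n + 1) n (by simp)).apply_apply_eq_zero z

/-- The map sending a cocycle to its class in `Ext`. -/
def extMkOfOpcycles : ((homComplexOp P Y).opcycles n).unop →ₗ[S] Abelian.Ext X Y n where
  toFun z := P.extMk (cocycleOfOpcycles P Y n z) (n + 1) rfl (d_comp_cocycleOfOpcycles P z)
  map_add' z w := by
    rw [P.add_extMk]
    congr 1
    exact map_add ((homComplexOp P Y).pOpcycles n).unop.hom z w
  map_smul' r z := by
    rw [RingHom.id_apply, Abelian.Ext.smul_eq_comp_mk₀, P.extMk_comp_mk₀]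
    congr 1
    refine (map_smul ((homComplexOp P Y).pOpcycles n).unop.hom r z).trans ?_
    rw [Linear.comp_smul, Category.comp_id]
    rfl

lemma extMkOfOpcycles_surjective : Function.Surjective (extMkOfOpcycles P Y n) := by
  intro e
  obtain ⟨f, hf, rfl⟩ := P.extMk_surjective e (n + 1) rfl
  obtain ⟨z, rfl⟩ := (pOpcycles_unop_exact (homComplexOp P Y) (n + 1) n (by simp) f).1 hf
  exact ⟨z, rfl⟩

lemma ker_extMkOfOpcycles : LinearMap.ker (extMkOfOpcycles P Y n) =
    LinearMap.ker ((homComplexOp P Y).homologyι n).unop.hom := by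
  ext z
  rw [LinearMap.mem_ker, LinearMap.mem_ker, homologyι_unop_exact (homComplexOp P Y) n _ rfl z]
  refine (extMk_eq_zero_iff_next P Y n _ (d_comp_cocycleOfOpcycles P z)).trans (exists_congr fun g ↦ ?_)
  have h : ((homComplexOp P Y).pOpcycles n).unop.hom
      (((homComplexOp P Y).fromOpcycles n ((ComplexShape.down ℕ).next n)).unop.hom g) =
      P.complex.d n _ ≫ g := by
    change (((homComplexOp P Y).fromOpcycles n _).unop ≫
      ((homComplexOp P Y).pOpcycles n).unop).hom g = _
    rw [← unop_comp, HomologicalComplex.p_fromOpcycles]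
    rfl
  rw [← h]
  exact (pOpcycles_unop_injective (homComplexOp P Y) n).eq_iff

end ExtComparison

section ExtComparisonNaturality

open Opposite

variable {S : Type u} [CommRing S] {X X' : ModuleCat.{u} S}

/-- The class in the derived functor `Ext` of an element of the dual of the opcycles. -/
def derivedExtOfOpcycles (P : ProjectiveResolution X) (Y : ModuleCat.{u} S) (n : ℕ) :
    ((homComplexOp P Y).opcycles n).unop →ₗ[S]
      ((Ext S (ModuleCat.{u} S) n).obj (op X)).obj Y :=
  ((P.isoLeftDerivedObj ((linearYoneda S (ModuleCat.{u} S)).obj Y).rightOp n).hom.unop.hom).comp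
    ((homComplexOp P Y).homologyι n).unop.hom

lemma isoLeftDerivedObj_unop_bijective (P : ProjectiveResolution X) (Y : ModuleCat.{u} S) (n : ℕ) :
    Function.Bijective
      (P.isoLeftDerivedObj ((linearYoneda S (ModuleCat.{u} S)).obj Y).rightOp n).hom.unop.hom :=
  ConcreteCategory.bijective_of_isIso
    (P.isoLeftDerivedObj ((linearYoneda S (ModuleCat.{u} S)).obj Y).rightOp n).hom.unop

lemma derivedExtOfOpcycles_surjective (P : ProjectiveResolution X) (Y : ModuleCat.{u} S) (n : ℕ) :
    Function.Surjective (derivedExtOfOpcycles P Y n) :=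
  (isoLeftDerivedObj_unop_bijective P Y n).2.comp (homologyι_unop_surjective _ n)

lemma ker_derivedExtOfOpcycles (P : ProjectiveResolution X) (Y : ModuleCat.{u} S) (n : ℕ) :
    LinearMap.ker (derivedExtOfOpcycles P Y n) = LinearMap.ker (extMkOfOpcycles P Y n) := by
  rw [ker_extMkOfOpcycles]
  exact LinearMap.ker_comp_of_ker_eq_bot _
    (LinearMap.ker_eq_bot.2 (isoLeftDerivedObj_unop_bijective P Y n).1)

/-- The comparison between `Ext` defined by the derived category and by derived functors. -/
def derivedExtEquiv (X Y : ModuleCat.{u} S) (n : ℕ) :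
    Abelian.Ext X Y n ≃ₗ[S] ((Ext S (ModuleCat.{u} S) n).obj (op X)).obj Y :=
  ((extMkOfOpcycles (projectiveResolution X) Y n).quotKerEquivOfSurjective
    (extMkOfOpcycles_surjective _ Y n)).symm ≪≫ₗ
  Submodule.quotEquivOfEq _ _ (ker_derivedExtOfOpcycles (projectiveResolution X) Y n).symm ≪≫ₗ
  (derivedExtOfOpcycles (projectiveResolution X) Y n).quotKerEquivOfSurjective
    (derivedExtOfOpcycles_surjective _ Y n)

lemma derivedExtEquiv_extMkOfOpcycles (X Y : ModuleCat.{u} S) (n : ℕ)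
    (z : ((homComplexOp (projectiveResolution X) Y).opcycles n).unop) :
    derivedExtEquiv X Y n (extMkOfOpcycles _ Y n z) = derivedExtOfOpcycles _ Y n z := by
  have h : ((extMkOfOpcycles (projectiveResolution X) Y n).quotKerEquivOfSurjective
      (extMkOfOpcycles_surjective _ Y n)).symm (extMkOfOpcycles _ Y n z) =
      Submodule.Quotient.mk z := by
    rw [LinearEquiv.symm_apply_eq]
    rfl
  rw [derivedExtEquiv, LinearEquiv.trans_apply, LinearEquiv.trans_apply, h]
  rfl

lemma derivedExtEquiv_naturality (Y : ModuleCat.{u} S) (n : ℕ) (g : X' ⟶ X)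
    (e : Abelian.Ext X Y n) :
    (((Ext S (ModuleCat.{u} S) n).map g.op).app Y).hom (derivedExtEquiv X Y n e) =
      derivedExtEquiv X' Y n ((Abelian.Ext.mk₀ g).comp e (zero_add n)) := by
  set P := projectiveResolution X with hP
  set P' := projectiveResolution X' with hP'
  obtain ⟨z, rfl⟩ := extMkOfOpcycles_surjective P Y n e
  let φ := ProjectiveResolution.lift g P' P
  have hφ : φ.f 0 ≫ P.π.f 0 = P'.π.f 0 ≫ g := by
    have := HomologicalComplex.congr_hom (ProjectiveResolution.lift_commutes g P' P) 0
    rwa [HomologicalComplex.comp_f, HomologicalComplex.comp_f,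
      ChainComplex.single₀_map_f_zero] at this
  let Φ : ProjectiveResolution.Hom P' P g := ⟨φ, by simpa using hφ⟩
  let κ : homComplexOp P' Y ⟶ homComplexOp P Y :=
    (((linearYoneda S (ModuleCat.{u} S)).obj Y).rightOp.mapHomologicalComplex _).map φ
  set z' := (HomologicalComplex.opcyclesMap κ n).unop.hom z with hz'
  have hc : cocycleOfOpcycles P' Y n z' = φ.f n ≫ cocycleOfOpcycles P Y n z := by
    have := congrArg Quiver.Hom.unop (HomologicalComplex.p_opcyclesMap κ n)
    exact ConcreteCategory.congr_hom this z
  have h1 : (Abelian.Ext.mk₀ g).comp (extMkOfOpcycles P Y n z) (zero_add n) =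
      extMkOfOpcycles P' Y n z' := by
    refine (ProjectiveResolution.mk₀_comp_extMk _ (n + 1) rfl
      (d_comp_cocycleOfOpcycles P z) Φ).trans ?_
    change _ = P'.extMk _ (n + 1) rfl (d_comp_cocycleOfOpcycles P' z')
    congr 1
    exact hc.symm
  rw [h1, derivedExtEquiv_extMkOfOpcycles, derivedExtEquiv_extMkOfOpcycles]
  have h2 := congrArg Quiver.Hom.unop (ProjectiveResolution.isoLeftDerivedObj_hom_naturality
    g P' P φ hφ ((linearYoneda S (ModuleCat.{u} S)).obj Y).rightOp n)
  have h3 := congrArg Quiver.Hom.unop (HomologicalComplex.homologyι_naturality κ n)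
  have h4 := ConcreteCategory.congr_hom h2 (((homComplexOp P Y).homologyι n).unop.hom z)
  have h5 := ConcreteCategory.congr_hom h3 z
  refine h4.trans ?_
  exact congrArg
    (P'.isoLeftDerivedObj ((linearYoneda S (ModuleCat.{u} S)).obj Y).rightOp n).hom.unop.hom h5

end ExtComparisonNaturality

section LocalCohomology

open Limits Opposite

variable {R : Type u} [CommRing R]

lemma isLocalCohomology_localCohomology (I : Ideal R) (i : ℕ) (M : Type u) [AddCommGroup M]
    [Module R M] :
    IsLocalCohomology I i M ↥((localCohomology I i).obj (ModuleCat.of R M)) := by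
  have := localCohomology.hasColimitDiagram.{u, 0} (localCohomology.idealPowersDiagram I) i
  have : PreservesFilteredColimitsOfSize.{0, 0} (forget (ModuleCat.{u} R)) :=
    preservesFilteredColimitsOfSize_shrink.{0, u, 0, u} _
  let F := localCohomology.diagram (localCohomology.idealPowersDiagram I) i
  let ev := (evaluation (ModuleCat.{u} R) (ModuleCat.{u} R)).obj (ModuleCat.of R M)
  let c := ev.mapCocone (colimit.cocone F)
  have hc : IsColimit c := isColimitOfPreserves ev (colimit.isColimit F)
  let Ψ (n : ℕ) : ModuleExt R (R ⧸ I ^ n) M i ≃ₗ[R] (F ⋙ ev).obj (op (op n)) :=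
    derivedExtEquiv (ModuleCat.of R (R ⧸ I ^ n)) (ModuleCat.of R M) i
  have hΨ (n m : ℕ) (h : n ≤ m) (f : op (op n) ⟶ op (op m)) (e : ModuleExt R (R ⧸ I ^ n) M i) :
      ((F ⋙ ev).map f).hom (Ψ n e) = Ψ m (ModuleExt.pre M (quotientPowMap I h) i e) :=
    derivedExtEquiv_naturality (ModuleCat.of R M) i
      (ModuleCat.ofHom (quotientPowMap I h)) e
  refine ⟨fun n ↦ (c.ι.app (op (op n))).hom ∘ₗ (Ψ n).toLinearMap, fun n m h e ↦ ?_, fun a ↦ ?_,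
    fun n e he ↦ ?_⟩
  · let f : op (op n) ⟶ op (op m) := (homOfLE h).op.op
    have := ConcreteCategory.congr_hom (c.w f) (Ψ n e)
    refine Eq.trans ?_ this
    exact congrArg (c.ι.app (op (op m))).hom (hΨ n m h f e).symm
  · obtain ⟨j, y, hy⟩ := Concrete.isColimit_exists_rep (F ⋙ ev) hc a
    refine ⟨j.unop.unop, (Ψ j.unop.unop).symm y, ?_⟩
    refine Eq.trans ?_ hy
    exact congrArg (c.ι.app j).hom ((Ψ j.unop.unop).apply_symm_apply y)
  · obtain ⟨k, f, g, hfg⟩ := Concrete.isColimit_exists_of_rep_eq (F ⋙ ev) hc (i := op (op n))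
      (j := op (op n)) (Ψ n e) 0 (he.trans (map_zero (c.ι.app (op (op n))).hom).symm)
    have h : n ≤ k.unop.unop := leOfHom f.unop.unop
    refine ⟨k.unop.unop, h, (Ψ k.unop.unop).injective ?_⟩
    rw [map_zero, ← hΨ n _ h f]
    exact hfg.trans (map_zero ((F ⋙ ev).map g).hom)

end LocalCohomology

theorem stmt17 (R : Type u) [CommRing R] [IsNoetherianRing R] [IsLocalRing R] [IsDomain R]
    [UniqueFactorizationMonoid R] (hdim : ringKrullDim R = 4)
    (I : Ideal R) (M : Type u) [AddCommGroup M] [Module R M] [Module.Finite R M] :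
    ∃ D : Ideal R, ringKrullDim (R ⧸ D) ≤ 1 ∧
      ∀ x ∈ D, ∀ i : ℕ,
        IsCofinite (Localization.Away x) (I.map (algebraMap R (Localization.Away x)))
          (ModuleCat.of (Localization.Away x)
            (LocalizedModule (Submonoid.powers x)
              ↥((localCohomology I i).obj (ModuleCat.of R M)))) := by
  obtain ⟨D, hD, hx⟩ := exists_extFiniteOfLow hdim.le I
  refine ⟨D, hD, fun x hxD i ↦ ⟨?_, fun j ↦ ?_⟩⟩
  · exact IsPowTorsion.support_subset ((isLocalCohomology_localCohomology I i
      M).isPowTorsion.localizedModule (Submonoid.powers x))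
  · have := extFinite_localizedModule (Submonoid.powers x) (hx x hxD) i M _
      (isLocalCohomology_localCohomology I i M) j
    exact Module.Finite.equiv (derivedExtEquiv
      (ModuleCat.of (Localization.Away x)
        (Localization.Away x ⧸ I.map (algebraMap R (Localization.Away x))))
      (ModuleCat.of (Localization.Away x) (LocalizedModule (Submonoid.powers x)
        ↥((localCohomology I i).obj (ModuleCat.of R M)))) j)
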